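/- arXiv:2505.07292 — 2 statements merged into one kernel-verified Lean document; each statement's English description precedes it below -/
import Mathlib

section
/- (Exponential decay of approximate singular states in the classically forbidden region.) Let Ω ⊆ M be an open periodic set whose exterior (the interior of the complement) is non-empty, and let ψ : closure(Ω) → ℝ be continuous and superharmonic in Ω, i.e. ψ(z₀) ≥ (1/2π)∫₀^{2π} ψ(z₀ + r e^{iθ}) dθ for every closed disc of center z₀ and radius r > 0 contained in Ω. Let 0 < τ < max_E φ − min_E φ and assume ψ ≥ φ on ∂Ω and ψ ≥ φ − τ on closure(Ω). Then for every ε > 0 there exists C_ε > 0 such that for all h ∈ (0,1] and every smooth periodic u : ℂ → ℂ satisfying ∫_E |u|² e^{−2φ/h} L(dz) ≤ 1 and ∫_E |h∂̄u|² e^{−2φ/h} L(dz) ≤ e^{−2τ/h}, one has ∫_{Ω∩E} |u|² e^{−2ψ/h} L(dz) ≤ C_ε² e^{2ε/h}. -/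
open MeasureTheory Real Complex

noncomputable section

/-- `f : ℂ → α` is 2π-periodic in both the real and the imaginary direction. -/
def PeriodicC {α : Type*} (f : ℂ → α) : Prop :=
  ∀ z : ℂ, f (z + (2 * Real.pi : ℝ)) = f z ∧ f (z + (2 * Real.pi : ℝ) * Complex.I) = f z

/-- The Cauchy–Riemann operator `∂̄ = (∂ₓ + i ∂_y)/2`. -/
noncomputable def dbar (u : ℂ → ℂ) (z : ℂ) : ℂ :=
  (fderiv ℝ u z 1 + Complex.I * fderiv ℝ u z Complex.I) / 2

/-- The Laplacian `Δ = ∂ₓ² + ∂_y²` of a real-valued function on `ℂ ≅ ℝ²`. -/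
noncomputable def lapC (f : ℂ → ℝ) (z : ℂ) : ℝ :=
  fderiv ℝ (fun w => fderiv ℝ f w 1) z 1 +
    fderiv ℝ (fun w => fderiv ℝ f w Complex.I) z Complex.I

/-- The fundamental domain `E = [0,2π) × [0,2π)`. -/
def Efd : Set ℂ :=
  {z : ℂ | z.re ∈ Set.Ico 0 (2 * Real.pi) ∧ z.im ∈ Set.Ico 0 (2 * Real.pi)}

/-- The squared weighted norm `‖u‖_{φ,h}² = ∫_E |u|² e^{-2φ/h}`. -/
noncomputable def wInt (φ : ℂ → ℝ) (h : ℝ) (u : ℂ → ℂ) : ℝ :=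
  ∫ z in Efd, ‖u z‖ ^ 2 * Real.exp (-2 * φ z / h)

/-- The counting function `N(t,h)`: the supremum of `dim V` over finite-dimensional
complex subspaces `V` of smooth periodic functions on which `‖h ∂̄ u‖_{φ,h} ≤ t ‖u‖_{φ,h}`. -/
noncomputable def countN (φ : ℂ → ℝ) (t h : ℝ) : ℕ :=
  sSup {n : ℕ | ∃ V : Submodule ℂ (ℂ → ℂ),
    Module.finrank ℂ V = n ∧
    (∀ u ∈ V, ContDiff ℝ (⊤ : ℕ∞) u ∧ PeriodicC u) ∧
    (∀ u ∈ V, wInt φ h (fun z => (h : ℂ) * dbar u z) ≤ t ^ 2 * wInt φ h u)}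

/-- `v` is distributionally subharmonic on the open set `U`. -/
def DSubhOn (v : ℂ → ℝ) (U : Set ℂ) : Prop :=
  ∀ χ : ℂ → ℝ, ContDiff ℝ (⊤ : ℕ∞) χ → HasCompactSupport χ → (∀ z, 0 ≤ χ z) →
    tsupport χ ⊆ U → 0 ≤ ∫ z : ℂ, v z * lapC χ z

/-- `v` is distributionally superharmonic on the open set `U`. -/
def DSuphOn (v : ℂ → ℝ) (U : Set ℂ) : Prop :=
  ∀ χ : ℂ → ℝ, ContDiff ℝ (⊤ : ℕ∞) χ → HasCompactSupport χ → (∀ z, 0 ≤ χ z) →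
    tsupport χ ⊆ U → (∫ z : ℂ, v z * lapC χ z) ≤ 0

/-- `ψ` is superharmonic on `Ω` in the mean-value sense. -/
def SuperharmonicMV (ψ : ℂ → ℝ) (Ω : Set ℂ) : Prop :=
  ∀ (z₀ : ℂ) (r : ℝ), 0 < r → Metric.closedBall z₀ r ⊆ Ω →
    (1 / (2 * Real.pi)) *
        (∫ θ in (0 : ℝ)..(2 * Real.pi),
          ψ (z₀ + (r : ℂ) * Complex.exp ((θ : ℂ) * Complex.I))) ≤ ψ z₀

/-- A subset of `ℂ` invariant under translations by `2π` and `2πi`. -/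
def PeriodicSet (S : Set ℂ) : Prop :=
  ∀ z : ℂ, (z ∈ S ↔ z + (2 * Real.pi : ℝ) ∈ S) ∧
    (z ∈ S ↔ z + (2 * Real.pi : ℝ) * Complex.I ∈ S)

/-! ### Periodic functions -/

/-- The lattice vector `2πm + 2πin`. -/
def latticePt (m n : ℤ) : ℂ := m • ((2 * Real.pi : ℝ) : ℂ) + n • (((2 * Real.pi : ℝ) : ℂ) * I)

theorem PeriodicC.add_latticePt {α : Type*} {f : ℂ → α} (hf : PeriodicC f) (z : ℂ) (m n : ℤ) :
    f (z + latticePt m n) = f z := by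
  have h1 : Function.Periodic f ((2 * Real.pi : ℝ) : ℂ) := fun z => (hf z).1
  have h2 : Function.Periodic f (((2 * Real.pi : ℝ) : ℂ) * I) := fun z => (hf z).2
  rw [latticePt, ← add_assoc, h2.zsmul n, h1.zsmul m]

theorem exists_add_latticePt_mem_Efd (z : ℂ) : ∃ m n : ℤ, z + latticePt m n ∈ Efd := by
  have hp : (0 : ℝ) < 2 * Real.pi := Real.two_pi_pos
  obtain ⟨m, hm, -⟩ := existsUnique_add_zsmul_mem_Ico hp z.re 0
  obtain ⟨n, hn, -⟩ := existsUnique_add_zsmul_mem_Ico hp z.im 0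
  refine ⟨m, n, ?_, ?_⟩
  · simpa [latticePt] using hm
  · simpa [latticePt] using hn

theorem PeriodicC.map {α β : Type*} {f : ℂ → α} (hf : PeriodicC f) (g : α → β) :
    PeriodicC fun z => g (f z) :=
  fun z => ⟨congrArg g (hf z).1, congrArg g (hf z).2⟩

theorem PeriodicC.map₂ {α β γ : Type*} {f : ℂ → α} {g : ℂ → β} (hf : PeriodicC f)
    (hg : PeriodicC g) (k : α → β → γ) : PeriodicC fun z => k (f z) (g z) :=
  fun z => ⟨congrArg₂ k (hf z).1 (hg z).1, congrArg₂ k (hf z).2 (hg z).2⟩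

theorem PeriodicSet.periodicC {S : Set ℂ} (hS : PeriodicSet S) : PeriodicC (· ∈ S) :=
  fun z => ⟨propext (hS z).1.symm, propext (hS z).2.symm⟩

theorem PeriodicC.fderiv {F : Type*} [NormedAddCommGroup F] [NormedSpace ℝ F] {f : ℂ → F}
    (hf : PeriodicC f) : PeriodicC (fderiv ℝ f) := by
  intro z
  constructor
  · rw [← fderiv_comp_add_right, show (fun x => f (x + _)) = f from funext fun x => (hf x).1]
  · rw [← fderiv_comp_add_right, show (fun x => f (x + _)) = f from funext fun x => (hf x).2]

theorem measurableSet_Efd : MeasurableSet Efd :=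
  (measurableSet_Ico.preimage measurable_re).inter (measurableSet_Ico.preimage measurable_im)

/-- The closed square containing the unit neighbourhood of the fundamental domain. -/
def bigSquare : Set ℂ := Set.Icc (-1) (2 * Real.pi + 1) ×ℂ Set.Icc (-1) (2 * Real.pi + 1)

theorem isCompact_bigSquare : IsCompact bigSquare := isCompact_Icc.reProdIm isCompact_Icc

theorem mem_bigSquare_of_dist_lt {z w : ℂ} (hz : z ∈ Efd) (h : dist z w < 1) : w ∈ bigSquare := by
  have hre := abs_le.mp ((abs_re_le_norm (z - w)).trans (dist_eq z w ▸ h.le))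
  have him := abs_le.mp ((abs_im_le_norm (z - w)).trans (dist_eq z w ▸ h.le))
  simp only [sub_re, sub_im] at hre him
  obtain ⟨⟨h1, h2⟩, h3, h4⟩ := hz
  refine ⟨⟨?_, ?_⟩, ?_, ?_⟩ <;> linarith

theorem Efd_subset_bigSquare : Efd ⊆ bigSquare :=
  fun z hz => mem_bigSquare_of_dist_lt hz (by simp)

theorem Continuous.integrableOn_Efd {F : Type*} [NormedAddCommGroup F] {f : ℂ → F}
    (hf : Continuous f) : IntegrableOn f Efd :=
  (hf.continuousOn.integrableOn_compact isCompact_bigSquare).mono_set Efd_subset_bigSquare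

theorem PeriodicC.exists_norm_le {F : Type*} [NormedAddCommGroup F] {S : Set ℂ} {f : ℂ → F}
    (hS : PeriodicSet S) (hSc : IsClosed S) (hf : PeriodicC f) (hfc : ContinuousOn f S) :
    ∃ B, ∀ z ∈ S, ‖f z‖ ≤ B := by
  obtain ⟨B, hB⟩ := (isCompact_bigSquare.inter_right hSc).exists_bound_of_continuousOn
    (hfc.mono Set.inter_subset_right)
  refine ⟨B, fun z hz => ?_⟩
  obtain ⟨m, n, hmn⟩ := exists_add_latticePt_mem_Efd z
  rw [← hf.add_latticePt z m n]
  exact hB _ ⟨Efd_subset_bigSquare hmn, by rwa [← hS.periodicC.add_latticePt z m n] at hz⟩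

/-- A periodic function that is continuous on a closed periodic set is uniformly continuous
there. -/
theorem PeriodicC.exists_dist_le {S : Set ℂ} {f : ℂ → ℝ}
    (hS : PeriodicSet S) (hSc : IsClosed S) (hf : PeriodicC f) (hfc : ContinuousOn f S)
    {ε : ℝ} (hε : 0 < ε) :
    ∃ δ > 0, ∀ z ∈ S, ∀ w ∈ S, dist z w < δ → |f z - f w| ≤ ε := by
  have hu := (isCompact_bigSquare.inter_right hSc).uniformContinuousOn_of_continuous
    (hfc.mono Set.inter_subset_right)
  obtain ⟨δ, hδ, H⟩ := Metric.uniformContinuousOn_iff.mp hu ε hε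
  refine ⟨min δ 1, lt_min hδ one_pos, fun z hz w hw hzw => ?_⟩
  obtain ⟨m, n, hmn⟩ := exists_add_latticePt_mem_Efd z
  rw [← hf.add_latticePt z m n, ← hf.add_latticePt w m n]
  have hd : dist (z + latticePt m n) (w + latticePt m n) < min δ 1 := by simpa using hzw
  refine (H _ ⟨Efd_subset_bigSquare hmn, ?_⟩ _
    ⟨mem_bigSquare_of_dist_lt hmn (hd.trans_le (min_le_right _ _)), ?_⟩
    (hd.trans_le (min_le_left _ _))).le
  · rwa [← hS.periodicC.add_latticePt z m n] at hz
  · rwa [← hS.periodicC.add_latticePt w m n] at hw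

/-! ### The divergence theorem and the weighted estimate -/

theorem setIntegral_Efd_eq {f : ℂ → ℝ} (hf : Continuous f) :
    ∫ z in Efd, f z =
      ∫ x in (0 : ℝ)..(2 * Real.pi), ∫ y in (0 : ℝ)..(2 * Real.pi), f (x + y * I) := by
  have hpre : measurableEquivRealProd.symm ⁻¹' Efd =
      Set.Ico 0 (2 * Real.pi) ×ˢ Set.Ico 0 (2 * Real.pi) := rfl
  have hfi : IntegrableOn (fun p : ℝ × ℝ => f (p.1 + p.2 * I))
      (Set.Ico 0 (2 * Real.pi) ×ˢ Set.Ico 0 (2 * Real.pi)) (volume.prod volume) := by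
    refine IntegrableOn.mono_set (ContinuousOn.integrableOn_compact
      (isCompact_Icc.prod isCompact_Icc) (by fun_prop)) (Set.prod_mono Set.Ico_subset_Icc_self
        Set.Ico_subset_Icc_self)
  rw [← volume_preserving_equiv_real_prod.symm.setIntegral_preimage_emb
    measurableEquivRealProd.symm.measurableEmbedding, hpre]
  have : ∀ p : ℝ × ℝ, f (measurableEquivRealProd.symm p) = f (p.1 + p.2 * I) := fun p =>
    congrArg f (mk_eq_add_mul_I p.1 p.2)
  simp_rw [this]
  rw [Measure.volume_eq_prod, setIntegral_prod _ hfi]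
  simp_rw [intervalIntegral.integral_of_le Real.two_pi_pos.le, integral_Ico_eq_integral_Ioc]

theorem integral_divergence_eq_zero {A B : ℂ → ℝ} (hA : ContDiff ℝ 1 A) (hB : ContDiff ℝ 1 B)
    (hAp : PeriodicC A) (hBp : PeriodicC B) :
    ∫ z in Efd, (fderiv ℝ A z 1 + fderiv ℝ B z I) = 0 := by
  have hAd := hA.differentiable one_ne_zero
  have hBd := hB.differentiable one_ne_zero
  have hcA : Continuous (fderiv ℝ A) := hA.continuous_fderiv one_ne_zero
  have hcB : Continuous (fderiv ℝ B) := hB.continuous_fderiv one_ne_zero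
  set f : ℂ → ℂ := fun z => (B z : ℂ) + A z * I with hf
  have hfp : PeriodicC f := hBp.map₂ hAp fun b a => (b : ℂ) + a * I
  set f' : ℂ → ℂ →L[ℝ] ℂ := fun z =>
    ofRealCLM.comp (fderiv ℝ B z) + (ofRealCLM.comp (fderiv ℝ A z)).smulRight I with hf'
  have hfd : ∀ z, HasFDerivAt f (f' z) z := fun z =>
    (ofRealCLM.hasFDerivAt.comp z (hBd z).hasFDerivAt).add
      ((ofRealCLM.hasFDerivAt.comp z (hAd z).hasFDerivAt).mul_const' I)
  have hf'c : Continuous fun z => I • f' z 1 - f' z I := by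
    simp only [hf', add_apply, ContinuousLinearMap.comp_apply,
      ContinuousLinearMap.smulRight_apply, ofRealCLM_apply]
    fun_prop
  have key := integral_boundary_rect_of_continuousOn_of_hasFDerivAt_real f f' 0
    ((2 * Real.pi : ℝ) + (2 * Real.pi : ℝ) * I)
    (fun z _ => (hfd z).continuousAt.continuousWithinAt) (fun z _ => hfd z)
    (hf'c.continuousOn.integrableOn_compact (isCompact_uIcc.reProdIm isCompact_uIcc))
  have h1 : ∀ x : ℝ, f (x + (2 * Real.pi : ℝ) * I) = f x := fun x => (hfp x).2
  have h2 : ∀ y : ℝ, f ((2 * Real.pi : ℝ) + y * I) = f (y * I) := fun y => by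
    rw [add_comm]; exact (hfp _).1
  have hcd : Continuous fun z => fderiv ℝ A z 1 + fderiv ℝ B z I := by fun_prop
  rw [setIntegral_Efd_eq hcd]
  have hre : ∀ z, (fderiv ℝ A z 1 + fderiv ℝ B z I) = - (I • f' z 1 - f' z I).re := by
    intro z
    simp [hf', add_comm]
  simp only [zero_re, zero_im, add_re, add_im, ofReal_re, ofReal_im, mul_re, mul_im, I_re, I_im,
    mul_zero, mul_one, zero_add, add_zero, ofReal_zero, zero_mul, h1, h2, sub_self]
    at key
  simp_rw [hre]
  simp only [intervalIntegral.integral_neg]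
  have hcomm : ∀ g : ℂ → ℂ, Continuous g →
      ∫ x in (0 : ℝ)..(2 * Real.pi), ∫ y in (0 : ℝ)..(2 * Real.pi), (g (x + y * I)).re =
        (∫ x in (0 : ℝ)..(2 * Real.pi), ∫ y in (0 : ℝ)..(2 * Real.pi), g (x + y * I)).re := by
    intro g hg
    have hre : ∀ k : ℝ → ℂ, Continuous k →
        ∫ x in (0 : ℝ)..(2 * Real.pi), (k x).re = (∫ x in (0 : ℝ)..(2 * Real.pi), k x).re :=
      fun k hk => reCLM.intervalIntegral_comp_comm (hk.intervalIntegrable _ _)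
    rw [← hre _ (intervalIntegral.continuous_parametric_intervalIntegral_of_continuous'
      (by fun_prop) _ _)]
    exact intervalIntegral.integral_congr fun x _ => hre _ (by fun_prop)
  rw [hcomm _ hf'c, ← key]
  simp

theorem fderiv_fderiv_comm {f : ℂ → ℝ} (hf : ContDiff ℝ 2 f) (z a b : ℂ) :
    fderiv ℝ (fun w => fderiv ℝ f w a) z b = fderiv ℝ (fun w => fderiv ℝ f w b) z a := by
  have hd : DifferentiableAt ℝ (fderiv ℝ f) z :=
    (hf.fderiv_right (m := 1) (by norm_num)).differentiable one_ne_zero z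
  have hs : IsSymmSndFDerivAt ℝ f z := hf.contDiffAt.isSymmSndFDerivAt (by simp)
  rw [fderiv_clm_apply hd (differentiableAt_const a), fderiv_clm_apply hd (differentiableAt_const b)]
  simpa using hs b a

theorem ContDiff.fderiv_apply_const {f : ℂ → ℝ} (hf : ContDiff ℝ (⊤ : ℕ∞) f) (a : ℂ) :
    ContDiff ℝ (⊤ : ℕ∞) fun z => fderiv ℝ f z a :=
  (hf.fderiv_right (m := (⊤ : ℕ∞)) (by simp)).clm_apply contDiff_const

/-- The pointwise inequality behind the weighted estimate: up to a divergence, the squared norm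
of `(h∂̄ + ∂̄Ψ)(P + iQ)` dominates `-(h/2)(P² + Q²) ΔΨ`. -/
theorem divergence_sub_laplacian_le {P Q Ψ : ℂ → ℝ} (hP : ContDiff ℝ (⊤ : ℕ∞) P)
    (hQ : ContDiff ℝ (⊤ : ℕ∞) Q) (hΨ : ContDiff ℝ (⊤ : ℕ∞) Ψ) (h : ℝ) (z : ℂ) :
    fderiv ℝ (fun w => (h / 2) * ((P w * P w + Q w * Q w) * fderiv ℝ Ψ w 1)
        - h ^ 2 * (P w * fderiv ℝ Q w I)) z 1
      + fderiv ℝ (fun w => (h / 2) * ((P w * P w + Q w * Q w) * fderiv ℝ Ψ w I)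
        + h ^ 2 * (P w * fderiv ℝ Q w 1)) z I
      - (h / 2) * ((P z * P z + Q z * Q z) * lapC Ψ z)
    ≤ ((h * (fderiv ℝ P z 1 - fderiv ℝ Q z I)
          + fderiv ℝ Ψ z 1 * P z - fderiv ℝ Ψ z I * Q z) ^ 2
        + (h * (fderiv ℝ P z I + fderiv ℝ Q z 1)
          + fderiv ℝ Ψ z 1 * Q z + fderiv ℝ Ψ z I * P z) ^ 2) / 4 := by
  have hPd := (hP.differentiable (by simp) z).hasFDerivAt
  have hQd := (hQ.differentiable (by simp) z).hasFDerivAt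
  have hQd1 := ((hQ.fderiv_apply_const 1).differentiable (by simp) z).hasFDerivAt
  have hQdI := ((hQ.fderiv_apply_const I).differentiable (by simp) z).hasFDerivAt
  have hΨd1 := ((hΨ.fderiv_apply_const 1).differentiable (by simp) z).hasFDerivAt
  have hΨdI := ((hΨ.fderiv_apply_const I).differentiable (by simp) z).hasFDerivAt
  have hn := (hPd.mul hPd).add (hQd.mul hQd)
  have hA := ((hn.mul hΨd1).const_mul (h / 2)).sub ((hPd.mul hQdI).const_mul (h ^ 2))
  have hB := ((hn.mul hΨdI).const_mul (h / 2)).add ((hPd.mul hQd1).const_mul (h ^ 2))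
  have hsymm := fderiv_fderiv_comm (hQ.of_le (WithTop.coe_le_coe.mpr (le_top (a := (2 : ℕ∞))))) z 1 I
  have eA := DFunLike.congr_fun hA.fderiv 1
  have eB := DFunLike.congr_fun hB.fderiv I
  simp only [add_apply, sub_apply, smul_apply, smul_eq_mul] at eA eB
  refine (congrArg₂ (fun a b => a + b - (h / 2) * ((P z * P z + Q z * Q z) * lapC Ψ z))
    eA eB).trans_le ?_
  simp only [lapC, Pi.add_apply, Pi.mul_apply, hsymm]
  nlinarith [sq_nonneg (h * (fderiv ℝ P z 1 + fderiv ℝ Q z I)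
      - fderiv ℝ Ψ z 1 * P z - fderiv ℝ Ψ z I * Q z),
    sq_nonneg (h * (fderiv ℝ Q z 1 - fderiv ℝ P z I)
      - fderiv ℝ Ψ z 1 * Q z + fderiv ℝ Ψ z I * P z)]

/-- The weighted estimate for `∂̄` on functions supported where the weight is strictly
superharmonic. -/
theorem weighted_dbar_estimate {v : ℂ → ℂ} (hv : ContDiff ℝ (⊤ : ℕ∞) v) (hvp : PeriodicC v)
    {Ψ : ℂ → ℝ} (hΨ : ContDiff ℝ (⊤ : ℕ∞) Ψ) (hΨp : PeriodicC Ψ) {c h : ℝ} (hh : 0 < h)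
    (hlap : ∀ z, v z ≠ 0 → lapC Ψ z ≤ -c) :
    h / 2 * c * wInt Ψ h v ≤ wInt Ψ h (fun z => (h : ℂ) * dbar v z) := by
  set e : ℂ → ℝ := fun z => Real.exp (-Ψ z / h) with he
  have hes : ContDiff ℝ (⊤ : ℕ∞) e := by fun_prop
  set P : ℂ → ℝ := fun z => (v z).re * e z with hPdef
  set Q : ℂ → ℝ := fun z => (v z).im * e z with hQdef
  have hvre : ContDiff ℝ (⊤ : ℕ∞) fun z => (v z).re := reCLM.contDiff.comp hv
  have hvim : ContDiff ℝ (⊤ : ℕ∞) fun z => (v z).im := imCLM.contDiff.comp hv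
  have hP : ContDiff ℝ (⊤ : ℕ∞) P := hvre.mul hes
  have hQ : ContDiff ℝ (⊤ : ℕ∞) Q := hvim.mul hes
  have hep : PeriodicC e := hΨp.map fun t => Real.exp (-t / h)
  have hPp : PeriodicC P := hvp.map₂ hep fun a b => a.re * b
  have hQp : PeriodicC Q := hvp.map₂ hep fun a b => a.im * b
  have hee : ∀ z, Real.exp (-2 * Ψ z / h) = e z ^ 2 := by
    intro z
    rw [he, sq, ← Real.exp_add]; congr 1; ring
  set A : ℂ → ℝ := fun w => (h / 2) * ((P w * P w + Q w * Q w) * fderiv ℝ Ψ w 1)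
        - h ^ 2 * (P w * fderiv ℝ Q w I) with hA
  set B : ℂ → ℝ := fun w => (h / 2) * ((P w * P w + Q w * Q w) * fderiv ℝ Ψ w I)
        + h ^ 2 * (P w * fderiv ℝ Q w 1) with hB
  have hΨ1 := hΨ.fderiv_apply_const 1
  have hΨI := hΨ.fderiv_apply_const I
  have hQ1 := hQ.fderiv_apply_const 1
  have hQI := hQ.fderiv_apply_const I
  have hAs : ContDiff ℝ (⊤ : ℕ∞) A := by fun_prop
  have hBs : ContDiff ℝ (⊤ : ℕ∞) B := by fun_prop
  have hAp : PeriodicC A := ((hPp.map₂ hQp Prod.mk).map₂ (hΨp.fderiv.map₂ hQp.fderiv Prod.mk)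
    fun p q => (h / 2) * ((p.1 * p.1 + p.2 * p.2) * q.1 1) - h ^ 2 * (p.1 * q.2 I))
  have hBp : PeriodicC B := ((hPp.map₂ hQp Prod.mk).map₂ (hΨp.fderiv.map₂ hQp.fderiv Prod.mk)
    fun p q => (h / 2) * ((p.1 * p.1 + p.2 * p.2) * q.1 I) + h ^ 2 * (p.1 * q.2 1))
  have hdiv := integral_divergence_eq_zero (hAs.of_le (by exact_mod_cast le_top))
    (hBs.of_le (by exact_mod_cast le_top)) hAp hBp
  have hdbar : ∀ z, ‖(h : ℂ) * dbar v z‖ ^ 2 * Real.exp (-2 * Ψ z / h) =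
      ((h * (fderiv ℝ P z 1 - fderiv ℝ Q z I)
          + fderiv ℝ Ψ z 1 * P z - fderiv ℝ Ψ z I * Q z) ^ 2
        + (h * (fderiv ℝ P z I + fderiv ℝ Q z 1)
          + fderiv ℝ Ψ z 1 * Q z + fderiv ℝ Ψ z I * P z) ^ 2) / 4 := by
    intro z
    have hvd := (hv.differentiable (by simp) z).hasFDerivAt
    have hΨd := (hΨ.differentiable (by simp) z).hasFDerivAt
    have hed : HasFDerivAt e (-(e z / h) • fderiv ℝ Ψ z) z := by
      have := (hΨd.neg.mul_const (h⁻¹)).exp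
      rw [show -(e z / h) • fderiv ℝ Ψ z
        = Real.exp ((-Ψ) z * h⁻¹) • h⁻¹ • -fderiv ℝ Ψ z by
          rw [smul_neg, smul_neg, smul_smul, neg_smul]; rfl]
      exact this
    have hPd : ∀ a, fderiv ℝ P z a = (v z).re * (-(e z / h) * fderiv ℝ Ψ z a)
        + e z * (fderiv ℝ v z a).re :=
      DFunLike.congr_fun ((reCLM.hasFDerivAt.comp z hvd).mul hed).fderiv
    have hQd : ∀ a, fderiv ℝ Q z a = (v z).im * (-(e z / h) * fderiv ℝ Ψ z a)
        + e z * (fderiv ℝ v z a).im :=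
      DFunLike.congr_fun ((imCLM.hasFDerivAt.comp z hvd).mul hed).fderiv
    rw [hee, norm_mul, mul_pow, ← Complex.normSq_eq_norm_sq (dbar v z), Complex.normSq_apply,
      hPd, hPd, hQd, hQd, hPdef, hQdef, dbar]
    simp
    field_simp
    ring
  have hpt : ∀ z, (fderiv ℝ A z 1 + fderiv ℝ B z I) +
      h / 2 * c * (‖v z‖ ^ 2 * Real.exp (-2 * Ψ z / h)) ≤
      ‖(h : ℂ) * dbar v z‖ ^ 2 * Real.exp (-2 * Ψ z / h) := by
    intro z
    have h1 := divergence_sub_laplacian_le hP hQ hΨ h z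
    rw [← hdbar] at h1
    have h2 : ‖v z‖ ^ 2 * Real.exp (-2 * Ψ z / h) = P z * P z + Q z * Q z := by
      rw [hee, ← Complex.normSq_eq_norm_sq, Complex.normSq_apply, hPdef, hQdef]; ring
    have h3 : c * (P z * P z + Q z * Q z) ≤ -((P z * P z + Q z * Q z) * lapC Ψ z) := by
      by_cases hz : v z = 0
      · simp [hPdef, hQdef, hz]
      · nlinarith [hlap z hz, mul_self_nonneg (P z), mul_self_nonneg (Q z)]
    rw [h2]
    have := mul_le_mul_of_nonneg_left h3 (half_pos hh).le
    linarith
  have hAc : Continuous (fderiv ℝ A) := hAs.continuous_fderiv (by simp)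
  have hBc : Continuous (fderiv ℝ B) := hBs.continuous_fderiv (by simp)
  have hvc := hv.continuous
  have hΨc := hΨ.continuous
  have hvdc : Continuous (fderiv ℝ v) := hv.continuous_fderiv (by simp)
  have i1 : IntegrableOn (fun z => fderiv ℝ A z 1 + fderiv ℝ B z I) Efd :=
    Continuous.integrableOn_Efd (by fun_prop)
  have i2 : IntegrableOn (fun z => h / 2 * c * (‖v z‖ ^ 2 * Real.exp (-2 * Ψ z / h))) Efd :=
    Continuous.integrableOn_Efd (by fun_prop)
  have i3 : IntegrableOn (fun z => ‖(h : ℂ) * dbar v z‖ ^ 2 * Real.exp (-2 * Ψ z / h)) Efd :=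
    Continuous.integrableOn_Efd (by unfold dbar; fun_prop)
  calc h / 2 * c * wInt Ψ h v
      = ∫ z in Efd, ((fderiv ℝ A z 1 + fderiv ℝ B z I) +
          h / 2 * c * (‖v z‖ ^ 2 * Real.exp (-2 * Ψ z / h))) := by
        rw [integral_add i1 i2, hdiv, zero_add, integral_const_mul, wInt]
    _ ≤ _ := integral_mono (Integrable.add i1 i2) i3 hpt

/-! ### A periodic function that is strictly subharmonic off a small disc -/

/-- `4 cos x - cos² x`, whose second derivative at its minimum is larger than the absolute value
of that at its maximum. -/
def unevenCos (x : ℝ) : ℝ := 4 * Real.cos x - Real.cos x ^ 2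

theorem hasDerivAt_unevenCos (x : ℝ) :
    HasDerivAt unevenCos (-(4 * Real.sin x) + 2 * Real.cos x * Real.sin x) x := by
  have := ((Real.hasDerivAt_cos x).const_mul 4).sub ((Real.hasDerivAt_cos x).pow 2)
  exact this.congr_deriv (by norm_num)

theorem hasDerivAt_deriv_unevenCos (x : ℝ) :
    HasDerivAt (fun x => -(4 * Real.sin x) + 2 * Real.cos x * Real.sin x)
      (-4 * Real.cos x + 2 * (Real.cos x ^ 2 - Real.sin x ^ 2)) x := by
  have := ((Real.hasDerivAt_sin x).const_mul 4).neg.add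
    (((Real.hasDerivAt_cos x).const_mul 2).mul (Real.hasDerivAt_sin x))
  exact this.congr_deriv (by ring)

/-- `exp (Λ (a(x - x₀) + a(y - y₀)))` with `a = unevenCos`. -/
def bumpyExp (Λ : ℝ) (z₀ z : ℂ) : ℝ :=
  Real.exp (Λ * (unevenCos (z.re - z₀.re) + unevenCos (z.im - z₀.im)))

theorem contDiff_bumpyExp (Λ : ℝ) (z₀ : ℂ) : ContDiff ℝ (⊤ : ℕ∞) (bumpyExp Λ z₀) := by
  have hre : ContDiff ℝ (⊤ : ℕ∞) re := reCLM.contDiff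
  have him : ContDiff ℝ (⊤ : ℕ∞) im := imCLM.contDiff
  unfold bumpyExp unevenCos
  fun_prop

theorem periodicC_bumpyExp (Λ : ℝ) (z₀ : ℂ) : PeriodicC (bumpyExp Λ z₀) := by
  intro z
  constructor <;> simp [bumpyExp, unevenCos, add_sub_right_comm, Real.cos_add_two_pi]

theorem abs_unevenCos_le (x : ℝ) : |unevenCos x| ≤ 5 := by
  rw [abs_le, unevenCos]
  constructor <;> nlinarith [Real.neg_one_le_cos x, Real.cos_le_one x]

theorem lapC_bumpyExp (Λ : ℝ) (z₀ z : ℂ) :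
    lapC (bumpyExp Λ z₀) z = bumpyExp Λ z₀ z * (
      (Λ * (-(4 * Real.sin (z.re - z₀.re)) +
        2 * Real.cos (z.re - z₀.re) * Real.sin (z.re - z₀.re))) ^ 2 +
      (Λ * (-(4 * Real.sin (z.im - z₀.im)) +
        2 * Real.cos (z.im - z₀.im) * Real.sin (z.im - z₀.im))) ^ 2 +
      Λ * (-4 * Real.cos (z.re - z₀.re) +
        2 * (Real.cos (z.re - z₀.re) ^ 2 - Real.sin (z.re - z₀.re) ^ 2)) +
      Λ * (-4 * Real.cos (z.im - z₀.im) +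
        2 * (Real.cos (z.im - z₀.im) ^ 2 - Real.sin (z.im - z₀.im) ^ 2))) := by
  have hre : ∀ w : ℂ, HasFDerivAt (fun w : ℂ => w.re - z₀.re) reCLM w := fun w =>
    reCLM.hasFDerivAt.sub_const _
  have him : ∀ w : ℂ, HasFDerivAt (fun w : ℂ => w.im - z₀.im) imCLM w := fun w =>
    imCLM.hasFDerivAt.sub_const _
  have hρ : ∀ w, HasFDerivAt (bumpyExp Λ z₀) (bumpyExp Λ z₀ w • Λ •
      ((-(4 * Real.sin (w.re - z₀.re)) +
          2 * Real.cos (w.re - z₀.re) * Real.sin (w.re - z₀.re)) • reCLM +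
        (-(4 * Real.sin (w.im - z₀.im)) +
          2 * Real.cos (w.im - z₀.im) * Real.sin (w.im - z₀.im)) • imCLM)) w := by
    intro w
    have h1 := (hasDerivAt_unevenCos (w.re - z₀.re)).comp_hasFDerivAt w (hre w)
    have h2 := (hasDerivAt_unevenCos (w.im - z₀.im)).comp_hasFDerivAt w (him w)
    exact ((h1.add h2).const_mul Λ).exp
  have h1 : (fun w => fderiv ℝ (bumpyExp Λ z₀) w 1) = fun w => bumpyExp Λ z₀ w *
      (Λ * (-(4 * Real.sin (w.re - z₀.re)) +
        2 * Real.cos (w.re - z₀.re) * Real.sin (w.re - z₀.re))) := by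
    funext w
    rw [(hρ w).fderiv]
    simp
  have hI : (fun w => fderiv ℝ (bumpyExp Λ z₀) w I) = fun w => bumpyExp Λ z₀ w *
      (Λ * (-(4 * Real.sin (w.im - z₀.im)) +
        2 * Real.cos (w.im - z₀.im) * Real.sin (w.im - z₀.im))) := by
    funext w
    rw [(hρ w).fderiv]
    simp
  have h2 := DFunLike.congr_fun ((hρ z).mul (((hasDerivAt_deriv_unevenCos
    (z.re - z₀.re)).comp_hasFDerivAt z (hre z)).const_mul Λ)).fderiv 1
  have h3 := DFunLike.congr_fun ((hρ z).mul (((hasDerivAt_deriv_unevenCos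
    (z.im - z₀.im)).comp_hasFDerivAt z (him z)).const_mul Λ)).fderiv I
  rw [lapC, h1, hI]
  refine (congrArg₂ (· + ·) h2 h3).trans ?_
  simp
  ring

/-- Away from the maximum of the profile, the Laplacian of `bumpyExp` is bounded below. -/
theorem four_le_of_cos_le {Λ η s t : ℝ} (hη : 0 < η) (hη1 : η ≤ 1) (hΛ : Λ = 2 / η)
    (hs : -1 ≤ s) (hs1 : s ≤ 1) (ht : -1 ≤ t) (ht1 : t ≤ 1 - η) :
    4 ≤ Λ * (4 - 2 * s) ^ 2 * (1 - s ^ 2) + Λ * (4 - 2 * t) ^ 2 * (1 - t ^ 2)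
      + (-4 * s + 2 * (2 * s ^ 2 - 1)) + (-4 * t + 2 * (2 * t ^ 2 - 1)) := by
  have hΛη : Λ * η = 2 := by rw [hΛ]; field_simp
  have hΛ2 : 2 ≤ Λ := by rw [hΛ, le_div_iff₀ hη]; linarith
  have hs' : 0 ≤ (1 - s) * (1 + s) := mul_nonneg (by linarith) (by linarith)
  have ht' : 0 ≤ (1 - t) * (1 + t) := mul_nonneg (by linarith) (by linarith)
  have a1 : 4 ≤ (4 - 2 * s) ^ 2 := by nlinarith
  have a2 : 4 ≤ (4 - 2 * t) ^ 2 := by nlinarith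
  have b1 : Λ * ((1 - s) * (1 + s)) * 4 ≤ Λ * ((1 - s) * (1 + s)) * (4 - 2 * s) ^ 2 :=
    mul_le_mul_of_nonneg_left a1 (by positivity)
  have b2 : Λ * ((1 - t) * (1 + t)) * 4 ≤ Λ * ((1 - t) * (1 + t)) * (4 - 2 * t) ^ 2 :=
    mul_le_mul_of_nonneg_left a2 (by positivity)
  have c1 : 0 ≤ 4 * (1 - s) * (Λ * (1 + s) - s) :=
    mul_nonneg (by linarith) (by nlinarith)
  have c2 : 8 ≤ 4 * (1 - t) * (Λ * (1 + t) - t) := by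
    have hq : 0 ≤ (1 - η - t) * (1 + t) := mul_nonneg (by linarith) (by linarith)
    nlinarith
  nlinarith

theorem exists_abs_add_zsmul_lt_of_cos {r η a : ℝ} (hr : 0 < r) (hη : η ≤ 2 / Real.pi ^ 2 * r ^ 2)
    (ha : 1 - η < Real.cos a) : ∃ m : ℤ, |a + m • (2 * Real.pi)| < r := by
  obtain ⟨m, hm, -⟩ := existsUnique_add_zsmul_mem_Ico Real.two_pi_pos a (-Real.pi)
  refine ⟨m, ?_⟩
  have hcos : Real.cos (a + m • (2 * Real.pi)) = Real.cos a := by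
    rw [zsmul_eq_mul, Real.cos_add_int_mul_two_pi]
  have h1 := Real.cos_le_one_sub_mul_cos_sq (x := a + m • (2 * Real.pi))
    (abs_le.mpr ⟨hm.1, by linarith [hm.2]⟩)
  rw [hcos] at h1
  have h2 : 2 / Real.pi ^ 2 * (a + m • (2 * Real.pi)) ^ 2 < 2 / Real.pi ^ 2 * r ^ 2 := by linarith
  exact abs_lt_of_sq_lt_sq (lt_of_mul_lt_mul_left h2 (by positivity)) hr.le

theorem exists_strictly_subharmonic {Ω : Set ℂ} (hΩ : PeriodicSet Ω)
    (hext : (interior Ωᶜ).Nonempty) :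
    ∃ (ρ : ℂ → ℝ) (c M : ℝ), 0 < c ∧ 0 < M ∧ ContDiff ℝ (⊤ : ℕ∞) ρ ∧ PeriodicC ρ ∧
      (∀ z, 0 ≤ ρ z ∧ ρ z ≤ M) ∧ ∀ z ∈ Ω, c ≤ lapC ρ z := by
  obtain ⟨z₀, hz₀⟩ := hext
  obtain ⟨r, hr, hball⟩ := Metric.isOpen_iff.mp isOpen_interior z₀ hz₀
  set η : ℝ := min 1 (2 / Real.pi ^ 2 * (r / 2) ^ 2) with hηdef
  have hη : 0 < η := by positivity
  have hη1 : η ≤ 1 := min_le_left _ _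
  set Λ : ℝ := 2 / η with hΛ
  have hΛ0 : 0 < Λ := by positivity
  have hlow : ∀ z, Real.exp (-(10 * Λ)) ≤ bumpyExp Λ z₀ z := fun z => Real.exp_le_exp.mpr (by
    nlinarith [(abs_le.mp (abs_unevenCos_le (z.re - z₀.re))).1,
      (abs_le.mp (abs_unevenCos_le (z.im - z₀.im))).1])
  have hup : ∀ z, bumpyExp Λ z₀ z ≤ Real.exp (10 * Λ) := fun z => Real.exp_le_exp.mpr (by
    nlinarith [(abs_le.mp (abs_unevenCos_le (z.re - z₀.re))).2,
      (abs_le.mp (abs_unevenCos_le (z.im - z₀.im))).2])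
  refine ⟨bumpyExp Λ z₀, Real.exp (-(10 * Λ)) * (Λ * 4), Real.exp (10 * Λ), by positivity,
    by positivity, contDiff_bumpyExp Λ z₀, periodicC_bumpyExp Λ z₀,
    fun z => ⟨(Real.exp_pos _).le, hup z⟩, fun z hz => ?_⟩
  set a := z.re - z₀.re with ha
  set b := z.im - z₀.im with hb
  have hcos : Real.cos a ≤ 1 - η ∨ Real.cos b ≤ 1 - η := by
    by_contra! hcon
    obtain ⟨m, hm⟩ := exists_abs_add_zsmul_lt_of_cos (half_pos hr) (min_le_right _ _) hcon.1
    obtain ⟨n, hn⟩ := exists_abs_add_zsmul_lt_of_cos (half_pos hr) (min_le_right _ _) hcon.2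
    have hmem : z + latticePt m n ∈ Metric.ball z₀ r := by
      rw [Metric.mem_ball, Complex.dist_eq]
      refine (norm_le_abs_re_add_abs_im _).trans_lt ?_
      have e1 : (z + latticePt m n - z₀).re = a + m • (2 * Real.pi) := by
        simp [latticePt, ha]; ring
      have e2 : (z + latticePt m n - z₀).im = b + n • (2 * Real.pi) := by
        simp [latticePt, hb]; ring
      rw [e1, e2]
      linarith
    have := interior_subset (hball hmem)
    exact this ((hΩ.periodicC.add_latticePt z m n).symm ▸ hz)
  have hs := Real.sin_sq a
  have ht := Real.sin_sq b
  have hmain : 4 ≤ Λ * (4 - 2 * Real.cos a) ^ 2 * (1 - Real.cos a ^ 2)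
      + Λ * (4 - 2 * Real.cos b) ^ 2 * (1 - Real.cos b ^ 2)
      + (-4 * Real.cos a + 2 * (2 * Real.cos a ^ 2 - 1))
      + (-4 * Real.cos b + 2 * (2 * Real.cos b ^ 2 - 1)) := by
    rcases hcos with hc | hc
    · have := four_le_of_cos_le hη hη1 hΛ (Real.neg_one_le_cos b) (Real.cos_le_one b)
        (Real.neg_one_le_cos a) hc
      linarith
    · exact four_le_of_cos_le hη hη1 hΛ (Real.neg_one_le_cos a) (Real.cos_le_one a)
        (Real.neg_one_le_cos b) hc
  rw [lapC_bumpyExp]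
  refine mul_le_mul (hlow z) ?_ (by positivity) (Real.exp_pos _).le
  refine (mul_le_mul_of_nonneg_left hmain hΛ0.le).trans (le_of_eq ?_)
  rw [← ha, ← hb]
  have e1 : (Λ * (-(4 * Real.sin a) + 2 * Real.cos a * Real.sin a)) ^ 2
      = Λ ^ 2 * (4 - 2 * Real.cos a) ^ 2 * Real.sin a ^ 2 := by ring
  have e2 : (Λ * (-(4 * Real.sin b) + 2 * Real.cos b * Real.sin b)) ^ 2
      = Λ ^ 2 * (4 - 2 * Real.cos b) ^ 2 * Real.sin b ^ 2 := by ring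
  rw [e1, e2, hs, ht]
  ring

/-! ### Mean values and the Laplacian -/

theorem exists_second_order_taylor {f : ℂ → ℝ} (hf : ContDiff ℝ 2 f) (z : ℂ) {c : ℝ}
    (hc : 0 < c) :
    ∃ δ > 0, ∀ w : ℂ, ‖w‖ < δ →
      |f (z + w) - f z - fderiv ℝ f z w - fderiv ℝ (fderiv ℝ f) z w w / 2| ≤ c * ‖w‖ ^ 2 := by
  have hd : DifferentiableAt ℝ (fderiv ℝ f) z :=
    (hf.fderiv_right (m := 1) (by norm_num)).differentiable one_ne_zero z
  have hs : IsSymmSndFDerivAt ℝ f z := hf.contDiffAt.isSymmSndFDerivAt (by simp)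
  set D := fderiv ℝ (fderiv ℝ f) z with hD
  have ho := hasFDerivAt_iff_isLittleO_nhds_zero.mp hd.hasFDerivAt
  obtain ⟨δ, hδ, H⟩ := Metric.eventually_nhds_iff.mp (ho.def hc)
  refine ⟨δ, hδ, fun w hw => ?_⟩
  set R : ℂ → ℝ := fun w => f (z + w) - f z - fderiv ℝ f z w - D w w / 2 with hR
  have hRd : ∀ x, HasFDerivAt R (fderiv ℝ f (z + x) - fderiv ℝ f z - D x) x := by
    intro x
    have h1 : HasFDerivAt (fun x => f (z + x)) (fderiv ℝ f (z + x)) x :=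
      (hf.differentiable two_ne_zero (z + x)).hasFDerivAt.comp x ((hasFDerivAt_id x).const_add z)
    have h2 : HasFDerivAt (fun x => D x x) (D x + D.flip x) x := by
      have := D.hasFDerivAt.clm_apply (hasFDerivAt_id x)
      refine this.congr_fderiv ?_
      ext y; simp
    have h3 := ((h1.sub_const (f z)).sub (fderiv ℝ f z).hasFDerivAt).sub (h2.mul_const (1 / 2))
    refine (h3.congr_fderiv ?_).congr_of_eventuallyEq (Filter.Eventually.of_forall fun y => ?_)
    · ext y
      have hxy : D x y = D y x := hs.eq x y
      simp only [sub_apply, add_apply, smul_apply, smul_eq_mul, ContinuousLinearMap.flip_apply]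
      linarith
    · simp [hR]; ring
  have hb : ∀ x ∈ Metric.closedBall (0 : ℂ) ‖w‖,
      ‖fderiv ℝ f (z + x) - fderiv ℝ f z - D x‖ ≤ c * ‖w‖ := by
    intro x hx
    have hx' : ‖x‖ ≤ ‖w‖ := by simpa using hx
    exact (H (by simpa using hx'.trans_lt hw)).trans (mul_le_mul_of_nonneg_left hx' hc.le)
  have := (convex_closedBall (0 : ℂ) ‖w‖).norm_image_sub_le_of_norm_hasFDerivWithin_le
    (fun x _ => (hRd x).hasFDerivWithinAt) hb (x := 0) (y := w) (by simp) (by simp)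
  have hR0 : R 0 = 0 := by simp [hR]
  rw [hR0, sub_zero, sub_zero, Real.norm_eq_abs] at this
  exact this.trans (le_of_eq (by ring))

theorem integral_trig_quadratic (k a b d e g : ℝ) :
    ∫ θ in (0 : ℝ)..(2 * Real.pi), (k + a * Real.cos θ + b * Real.sin θ +
      d * (Real.sin θ * Real.cos θ) + e * Real.cos θ ^ 2 + g * Real.sin θ ^ 2) =
      2 * Real.pi * k + Real.pi * (e + g) := by
  have hi : ∀ F : ℝ → ℝ, Continuous F → IntervalIntegrable F volume 0 (2 * Real.pi) :=
    fun F hF => hF.intervalIntegrable _ _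
  rw [intervalIntegral.integral_add (hi _ (by fun_prop)) (hi _ (by fun_prop)),
    intervalIntegral.integral_add (hi _ (by fun_prop)) (hi _ (by fun_prop)),
    intervalIntegral.integral_add (hi _ (by fun_prop)) (hi _ (by fun_prop)),
    intervalIntegral.integral_add (hi _ (by fun_prop)) (hi _ (by fun_prop)),
    intervalIntegral.integral_add (hi _ (by fun_prop)) (hi _ (by fun_prop))]
  simp only [intervalIntegral.integral_const_mul, intervalIntegral.integral_const, integral_cos,
    integral_sin, integral_sin_mul_cos₁, integral_cos_sq, integral_sin_sq]
  simp
  ring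

theorem lapC_nonpos_of_circle_mean_le {f : ℂ → ℝ} (hf : ContDiff ℝ 2 f) {z : ℂ} {δ : ℝ}
    (hδ : 0 < δ) (H : ∀ r, 0 < r → r < δ →
      ∫ θ in (0 : ℝ)..(2 * Real.pi), f (z + (r : ℂ) * Complex.exp ((θ : ℂ) * I)) ≤
        2 * Real.pi * f z) : lapC f z ≤ 0 := by
  have hd : DifferentiableAt ℝ (fderiv ℝ f) z :=
    (hf.fderiv_right (m := 1) (by norm_num)).differentiable one_ne_zero z
  have hlap : lapC f z = fderiv ℝ (fderiv ℝ f) z 1 1 + fderiv ℝ (fderiv ℝ f) z I I := by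
    rw [lapC, fderiv_clm_apply hd (differentiableAt_const 1),
      fderiv_clm_apply hd (differentiableAt_const I)]
    simp
  rw [hlap]
  set L := fderiv ℝ f z
  set D := fderiv ℝ (fderiv ℝ f) z
  refine le_of_forall_pos_le_add fun c hc => ?_
  obtain ⟨δ', hδ', hT⟩ := exists_second_order_taylor hf z (c := c / 4) (by positivity)
  obtain ⟨r, hr, hrlt⟩ := exists_between (lt_min hδ hδ')
  have hmean := H r hr (hrlt.trans_le (min_le_left _ _))
  have hlow : ∫ θ in (0 : ℝ)..(2 * Real.pi), ((f z - c / 4 * r ^ 2) + (r * L 1) * Real.cos θ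
      + (r * L I) * Real.sin θ + (r ^ 2 / 2 * (D 1 I + D I 1)) * (Real.sin θ * Real.cos θ)
      + (r ^ 2 / 2 * D 1 1) * Real.cos θ ^ 2 + (r ^ 2 / 2 * D I I) * Real.sin θ ^ 2) ≤
      ∫ θ in (0 : ℝ)..(2 * Real.pi), f (z + (r : ℂ) * Complex.exp ((θ : ℂ) * I)) := by
    have hfc := hf.continuous
    refine intervalIntegral.integral_mono_on Real.two_pi_pos.le
      (Continuous.intervalIntegrable (by fun_prop) _ _)
      (Continuous.intervalIntegrable (by fun_prop) _ _) fun θ _ => ?_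
    set w : ℂ := (r : ℂ) * Complex.exp ((θ : ℂ) * I) with hw
    have hwn : ‖w‖ = r := by
      rw [hw, norm_mul, Complex.norm_exp_ofReal_mul_I, mul_one, Complex.norm_real,
        Real.norm_of_nonneg hr.le]
    have hw2 : w = (r * Real.cos θ) • (1 : ℂ) + (r * Real.sin θ) • I := by
      rw [hw, Complex.exp_mul_I]
      simp
      ring
    have h1 := (abs_le.mp (hT w (hwn ▸ hrlt.trans_le (min_le_right _ _)))).1
    have hL : L w = r * Real.cos θ * L 1 + r * Real.sin θ * L I := by
      rw [hw2, map_add, map_smul, map_smul]; rfl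
    have hDw : D w w = (r * Real.cos θ) ^ 2 * D 1 1
        + (r * Real.cos θ) * (r * Real.sin θ) * (D 1 I + D I 1)
        + (r * Real.sin θ) ^ 2 * D I I := by
      rw [hw2]
      simp only [map_add, map_smul, add_apply, smul_apply, smul_eq_mul]
      ring
    rw [hL, hDw, hwn] at h1
    linarith
  rw [integral_trig_quadratic] at hlow
  have hfin : Real.pi * r ^ 2 / 2 * (D 1 1 + D I I) ≤ Real.pi * r ^ 2 / 2 * (0 + c) := by
    linarith
  exact le_of_mul_le_mul_left hfin (by positivity)

/-! ### Mollification -/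

/-- Convolution of `g` with a normalised bump function supported in the disc of radius `δ`. -/
def mollify (δ : ℝ) (hδ : 0 < δ) (g : ℂ → ℝ) : ℂ → ℝ :=
  convolution ((⟨δ / 2, δ, half_pos hδ, half_lt_self hδ⟩ : ContDiffBump (0 : ℂ)).normed volume) g
    (ContinuousLinearMap.lsmul ℝ ℝ) volume

section Mollify

variable {δ : ℝ} (hδ : 0 < δ) {g : ℂ → ℝ}

theorem locallyIntegrable_of_bounded {B : ℝ} (hg : Measurable g) (hB : ∀ z, ‖g z‖ ≤ B) :
    LocallyIntegrable g :=
  (locallyIntegrable_const B).mono hg.aestronglyMeasurable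
    (Filter.Eventually.of_forall fun z => (hB z).trans (le_abs_self B))

theorem contDiff_mollify (hg : LocallyIntegrable g) :
    ContDiff ℝ (⊤ : ℕ∞) (mollify δ hδ g) :=
  (ContDiffBump.hasCompactSupport_normed _).contDiff_convolution_left _
    (ContDiffBump.contDiff_normed _) hg

theorem periodicC_mollify (hg : PeriodicC g) : PeriodicC (mollify δ hδ g) := by
  intro z
  constructor <;> refine integral_congr_ae (Filter.Eventually.of_forall fun t => ?_)
  · simp only [add_sub_right_comm, (hg (z - t)).1]
  · simp only [add_sub_right_comm, (hg (z - t)).2]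

theorem abs_mollify_sub_le (hg : Measurable g) {z : ℂ} {ε : ℝ}
    (h : ∀ w ∈ Metric.ball z δ, |g w - g z| ≤ ε) : |mollify δ hδ g z - g z| ≤ ε :=
  ContDiffBump.dist_normed_convolution_le hg.aestronglyMeasurable h

theorem mollify_eq_of_ball {z : ℂ} (h : ∀ w ∈ Metric.ball z δ, g w = g z) :
    mollify δ hδ g z = g z :=
  ContDiffBump.normed_convolution_eq_right h

theorem mollify_mem_Icc (hg : Measurable g) {a b : ℝ} (hab : ∀ z, g z ∈ Set.Icc a b) (z : ℂ) :
    mollify δ hδ g z ∈ Set.Icc a b := by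
  have hd := dist_convolution_le (f := (⟨δ / 2, δ, half_pos hδ, half_lt_self hδ⟩ :
      ContDiffBump (0 : ℂ)).normed volume) (g := g) (μ := volume) (x₀ := z) (z₀ := (a + b) / 2)
    (R := δ) (ε := (b - a) / 2) (by linarith [(hab z).1.trans (hab z).2])
    (ContDiffBump.support_normed_eq _).subset (ContDiffBump.nonneg_normed _)
    (ContDiffBump.integral_normed _) hg.aestronglyMeasurable fun w _ => by
      rw [Real.dist_eq, abs_le]
      constructor <;> linarith [(hab w).1, (hab w).2]
  rw [Real.dist_eq, abs_le] at hd
  change _ ≤ mollify δ hδ g z - _ ∧ mollify δ hδ g z - _ ≤ _ at hd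
  constructor <;> linarith [hd.1, hd.2]

/-- Mollification preserves superharmonicity away from the boundary. -/
theorem lapC_mollify_nonpos {B : ℝ} (hg : Measurable g) (hB : ∀ z, ‖g z‖ ≤ B) {z : ℂ}
    (h : ∀ w ∈ Metric.ball z δ, ∀ r, 0 < r → r < δ →
      ∫ θ in (0 : ℝ)..(2 * Real.pi), g (w + (r : ℂ) * Complex.exp ((θ : ℂ) * I)) ≤
        2 * Real.pi * g w) : lapC (mollify δ hδ g) z ≤ 0 := by
  have hsm := contDiff_mollify hδ (locallyIntegrable_of_bounded hg hB)
  refine lapC_nonpos_of_circle_mean_le (hsm.of_le (WithTop.coe_le_coe.mpr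
    (le_top (a := (2 : ℕ∞))))) hδ fun r hr hrδ => ?_
  set b : ContDiffBump (0 : ℂ) := ⟨δ / 2, δ, half_pos hδ, half_lt_self hδ⟩ with hb
  set η : ℂ → ℝ := b.normed volume with hη
  have hηi : Integrable η := b.integrable_normed
  have hdef : ∀ x, mollify δ hδ g x = ∫ t, η t * g (x - t) := fun x => rfl
  set e : ℝ → ℂ := fun θ => (r : ℂ) * Complex.exp ((θ : ℂ) * I) with he
  have hec : Continuous e := by fun_prop
  have hfi : Integrable (Function.uncurry fun (θ : ℝ) (t : ℂ) => η t * g (z + e θ - t))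
      ((volume.restrict (Set.Ioc 0 (2 * Real.pi))).prod volume) := by
    refine ((hηi.norm.mul_const B).comp_snd _).mono' ?_
      (Filter.Eventually.of_forall fun p => ?_)
    · have hηm : Measurable η := b.continuous_normed.measurable
      have hem := hec.measurable
      exact Measurable.aestronglyMeasurable (by unfold Function.uncurry; fun_prop)
    · rw [Function.uncurry, norm_mul]
      exact mul_le_mul_of_nonneg_left (hB _) (norm_nonneg _)
  have hright : Integrable fun t => η t * (2 * Real.pi * g (z - t)) := by
    refine (hηi.norm.mul_const (2 * Real.pi * B)).mono' ?_
      (Filter.Eventually.of_forall fun t => ?_)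
    · have hηm : Measurable η := b.continuous_normed.measurable
      exact Measurable.aestronglyMeasurable (by fun_prop)
    · rw [norm_mul, norm_mul, Real.norm_of_nonneg Real.two_pi_pos.le]
      exact mul_le_mul_of_nonneg_left
        (mul_le_mul_of_nonneg_left (hB _) Real.two_pi_pos.le) (norm_nonneg _)
  calc ∫ θ in (0 : ℝ)..(2 * Real.pi), mollify δ hδ g (z + e θ)
      = ∫ t, ∫ θ in Set.Ioc 0 (2 * Real.pi), η t * g (z + e θ - t) := by
        rw [intervalIntegral.integral_of_le Real.two_pi_pos.le]
        simp_rw [hdef]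
        exact integral_integral_swap hfi
    _ ≤ ∫ t, η t * (2 * Real.pi * g (z - t)) := by
        refine integral_mono hfi.integral_prod_right hright fun t => ?_
        dsimp only
        rw [integral_const_mul]
        by_cases ht : t ∈ Metric.ball (0 : ℂ) δ
        · refine mul_le_mul_of_nonneg_left ?_ (b.nonneg_normed t)
          have := h (z - t) (by simpa using ht) r hr hrδ
          rw [intervalIntegral.integral_of_le Real.two_pi_pos.le] at this
          refine le_trans (le_of_eq ?_) this
          refine integral_congr_ae (Filter.Eventually.of_forall fun θ => ?_)
          simp only [he, add_sub_right_comm]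
        · have : η t = 0 := by
            rw [← Function.notMem_support, hη, b.support_normed_eq]
            exact ht
          simp [this]
    _ = 2 * Real.pi * mollify δ hδ g z := by
        rw [hdef, ← integral_const_mul]
        congr 1
        funext t
        ring

end Mollify

/-! ### Cutoffs and smooth weights -/

theorem PeriodicSet.closure {S : Set ℂ} (hS : PeriodicSet S) : PeriodicSet (closure S) := by
  have key : ∀ a : ℂ, (∀ z, z ∈ S ↔ z + a ∈ S) → ∀ z, z ∈ _root_.closure S ↔
      z + a ∈ _root_.closure S := by
    intro a ha z
    have h := (Homeomorph.addRight a).preimage_closure S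
    have h' : (Homeomorph.addRight a) ⁻¹' S = S := by
      ext w
      exact (ha w).symm
    rw [h'] at h
    exact (Set.ext_iff.mp h z).symm
  exact fun z => ⟨key _ (fun w => (hS w).1) z, key _ (fun w => (hS w).2) z⟩

theorem PeriodicSet.compl {S : Set ℂ} (hS : PeriodicSet S) : PeriodicSet Sᶜ :=
  fun z => ⟨not_congr (hS z).1, not_congr (hS z).2⟩

theorem PeriodicSet.periodicC_infDist {S : Set ℂ} (hS : PeriodicSet S) :
    PeriodicC fun z => Metric.infDist z S := by
  have key : ∀ a : ℂ, (∀ z, z ∈ S ↔ z + a ∈ S) → ∀ z,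
      Metric.infDist (z + a) S = Metric.infDist z S := by
    intro a ha z
    have himg : (IsometryEquiv.addRight a) '' S = S := by
      ext w
      rw [Set.mem_image]
      constructor
      · rintro ⟨y, hy, rfl⟩
        exact (ha y).1 hy
      · exact fun hw => ⟨w - a, (ha _).2 (by simpa using hw), by simp⟩
    have := Metric.infDist_image (IsometryEquiv.addRight a).isometry (x := z) (t := S)
    rwa [himg] at this
  exact fun z => ⟨key _ (fun w => (hS w).1) z, key _ (fun w => (hS w).2) z⟩

theorem PeriodicC.indicator {S : Set ℂ} (hS : PeriodicSet S) {f : ℂ → ℝ} (hf : PeriodicC f) :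
    PeriodicC (S.indicator f) := by
  classical
  intro z
  simp only [Set.indicator_apply]
  rw [(hf z).1, (hf z).2]
  simp only [← (hS z).1, ← (hS z).2, and_self]

theorem PeriodicC.periodicSet_preimage {α : Type*} {f : ℂ → α} (hf : PeriodicC f) (T : Set α) :
    PeriodicSet (f ⁻¹' T) := by
  intro z
  simp only [Set.mem_preimage, (hf z).1, (hf z).2, and_self]

theorem abs_infDist_sub_lt_of_mem_ball {S : Set ℂ} {z w : ℂ} {δ : ℝ} (hw : w ∈ Metric.ball z δ) :
    |Metric.infDist w S - Metric.infDist z S| < δ :=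
  lt_of_le_of_lt ((Metric.lipschitz_infDist_pt S).dist_le_mul w z |>.trans_eq (by simp))
    (Metric.mem_ball.1 hw)

theorem exists_cutoff {S : Set ℂ} (hS : PeriodicSet S) {δ : ℝ} (hδ : 0 < δ) :
    ∃ χ : ℂ → ℝ, ContDiff ℝ (⊤ : ℕ∞) χ ∧ PeriodicC χ ∧ (∀ z, χ z ∈ Set.Icc 0 1) ∧
      (∀ z, χ z ≠ 0 → 2 * δ ≤ Metric.infDist z S) ∧
      ∀ z, 4 * δ ≤ Metric.infDist z S → χ z = 1 := by
  set T : Set ℂ := (fun z => Metric.infDist z S) ⁻¹' Set.Ici (3 * δ) with hT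
  have hTm : MeasurableSet T := (Metric.continuous_infDist_pt S).measurable measurableSet_Ici
  set g : ℂ → ℝ := T.indicator fun _ => 1 with hgdef
  have hgm : Measurable g := measurable_const.indicator hTm
  have hg01 : ∀ z, g z ∈ Set.Icc (0 : ℝ) 1 := fun z =>
    ⟨Set.indicator_nonneg (fun _ _ => zero_le_one) z,
      Set.indicator_le_self' (fun _ _ => zero_le_one) z⟩
  have hgb : ∀ z, ‖g z‖ ≤ 1 := fun z => by
    rw [Real.norm_of_nonneg (hg01 z).1]
    exact (hg01 z).2
  have hgp : PeriodicC g :=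
    PeriodicC.indicator (hS.periodicC_infDist.periodicSet_preimage _) fun _ => ⟨rfl, rfl⟩
  refine ⟨mollify δ hδ g, contDiff_mollify hδ (locallyIntegrable_of_bounded hgm hgb),
    periodicC_mollify hδ hgp, mollify_mem_Icc hδ hgm hg01, fun z hz => ?_, fun z hz => ?_⟩
  · by_contra! hlt
    have h0 : ∀ w ∈ Metric.ball z δ, g w = 0 := fun w hw =>
      Set.indicator_of_notMem (s := T) (fun hwT => by
        have hwT' : 3 * δ ≤ Metric.infDist w S := hwT
        linarith [(abs_lt.1 (abs_infDist_sub_lt_of_mem_ball (S := S) hw)).2]) _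
    have hzz := h0 z (Metric.mem_ball_self hδ)
    exact hz ((mollify_eq_of_ball hδ fun w hw => (h0 w hw).trans hzz.symm).trans hzz)
  · have h1 : ∀ w ∈ Metric.ball z δ, g w = 1 := fun w hw =>
      Set.indicator_of_mem (s := T) (show 3 * δ ≤ Metric.infDist w S by
        linarith [(abs_lt.1 (abs_infDist_sub_lt_of_mem_ball (S := S) hw)).1]) _
    have hzz := h1 z (Metric.mem_ball_self hδ)
    exact (mollify_eq_of_ball hδ fun w hw => (h1 w hw).trans hzz.symm).trans hzz

theorem lapC_sub_const_mul {f g : ℂ → ℝ} (hf : ContDiff ℝ (⊤ : ℕ∞) f)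
    (hg : ContDiff ℝ (⊤ : ℕ∞) g) (s : ℝ) (z : ℂ) :
    lapC (fun w => f w - s * g w) z = lapC f z - s * lapC g z := by
  have key : ∀ {f g : ℂ → ℝ}, ContDiff ℝ (⊤ : ℕ∞) f → ContDiff ℝ (⊤ : ℕ∞) g → ∀ w a : ℂ,
      fderiv ℝ (fun w => f w - s * g w) w a = fderiv ℝ f w a - s * fderiv ℝ g w a := by
    intro f g hf hg w a
    have hf' := (hf.differentiable (by simp)) w
    have hg' := (hg.differentiable (by simp)) w
    rw [fderiv_fun_sub hf' (hg'.const_mul s), fderiv_const_mul hg']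
    rfl
  simp only [lapC, key hf hg]
  rw [key (hf.fderiv_apply_const 1) (hg.fderiv_apply_const 1),
    key (hf.fderiv_apply_const I) (hg.fderiv_apply_const I)]
  ring

/-- A continuous superharmonic function is uniformly close to smooth strictly superharmonic
functions away from the boundary. -/
theorem exists_smooth_weight {Ω : Set ℂ} (hΩo : IsOpen Ω) (hΩ : PeriodicSet Ω)
    (hext : (interior Ωᶜ).Nonempty) {ψ : ℂ → ℝ} (hψc : ContinuousOn ψ (closure Ω))
    (hψp : PeriodicC ψ) (hψsh : SuperharmonicMV ψ Ω) {δ ε : ℝ} (hδ : 0 < δ) (hε : 0 < ε)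
    (hδε : ∀ z ∈ closure Ω, ∀ w ∈ closure Ω, dist z w < δ → |ψ z - ψ w| ≤ ε) :
    ∃ (Ψ : ℂ → ℝ) (c : ℝ), 0 < c ∧ ContDiff ℝ (⊤ : ℕ∞) Ψ ∧ PeriodicC Ψ ∧
      ∀ z, 2 * δ ≤ Metric.infDist z Ωᶜ → |Ψ z - ψ z| ≤ 2 * ε ∧ lapC Ψ z ≤ -c := by
  obtain ⟨ρ, c, M, hc, hM, hρ, hρp, hρb, hρl⟩ := exists_strictly_subharmonic hΩ hext
  obtain ⟨B, hB⟩ := PeriodicC.exists_norm_le hΩ.closure isClosed_closure hψp hψc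
  have hmem : ∀ w, 0 < Metric.infDist w Ωᶜ → w ∈ Ω := fun w hw => by
    by_contra hn
    exact hw.ne' (Metric.infDist_zero_of_mem hn)
  set g : ℂ → ℝ := Ω.indicator ψ with hg
  have hgm : Measurable g := by
    classical
    rw [hg, ← Set.piecewise_eq_indicator]
    exact (hψc.mono subset_closure).measurable_piecewise continuousOn_const hΩo.measurableSet
  have hgb : ∀ z, ‖g z‖ ≤ |B| := fun z => by
    by_cases hz : z ∈ Ω
    · rw [hg, Set.indicator_of_mem hz]
      exact (hB z (subset_closure hz)).trans (le_abs_self B)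
    · rw [hg, Set.indicator_of_notMem hz, norm_zero]
      exact abs_nonneg B
  have hgΩ : ∀ w ∈ Ω, g w = ψ w := fun w hw => Set.indicator_of_mem hw ψ
  have hball : ∀ z, 2 * δ ≤ Metric.infDist z Ωᶜ → ∀ w ∈ Metric.ball z δ,
      δ < Metric.infDist w Ωᶜ := fun z hz w hw => by
    linarith [(abs_lt.1 (abs_infDist_sub_lt_of_mem_ball (S := Ωᶜ) hw)).1]
  have hf := contDiff_mollify hδ (locallyIntegrable_of_bounded hgm hgb)
  refine ⟨fun z => mollify δ hδ g z - ε / M * ρ z, ε / M * c, by positivity,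
    hf.sub (contDiff_const.mul hρ),
    (periodicC_mollify hδ (hψp.indicator hΩ)).map₂ hρp fun x y => x - ε / M * y,
    fun z hz => ?_⟩
  have hzΩ : z ∈ Ω := hmem z (by linarith)
  constructor
  · have h1 : |mollify δ hδ g z - g z| ≤ ε := abs_mollify_sub_le hδ hgm fun w hw => by
      have hwΩ := hmem w (hδ.trans (hball z hz w hw))
      rw [hgΩ w hwΩ, hgΩ z hzΩ]
      exact hδε w (subset_closure hwΩ) z (subset_closure hzΩ) hw
    have h2 : ε / M * ρ z ≤ ε := by
      calc ε / M * ρ z ≤ ε / M * M := by gcongr; exact (hρb z).2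
        _ = ε := by field_simp
    have h3 : 0 ≤ ε / M * ρ z := mul_nonneg (by positivity) (hρb z).1
    rw [hgΩ z hzΩ, abs_le] at h1
    rw [abs_le]
    constructor <;> linarith [h1.1, h1.2]
  · have h1 : lapC (mollify δ hδ g) z ≤ 0 := by
      refine lapC_mollify_nonpos hδ hgm hgb fun w hw r hr hrδ => ?_
      have hsub : Metric.closedBall w r ⊆ Ω := fun y hy => by
        refine hmem y ?_
        have hy' : y ∈ Metric.ball w δ := Metric.closedBall_subset_ball hrδ hy
        linarith [(abs_lt.1 (abs_infDist_sub_lt_of_mem_ball (S := Ωᶜ) hy')).1, hball z hz w hw]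
      have hmv := hψsh w r hr hsub
      rw [hgΩ w (hsub (Metric.mem_closedBall_self hr.le))]
      have heq : ∫ θ in (0 : ℝ)..(2 * Real.pi), g (w + (r : ℂ) * Complex.exp ((θ : ℂ) * I)) =
          ∫ θ in (0 : ℝ)..(2 * Real.pi), ψ (w + (r : ℂ) * Complex.exp ((θ : ℂ) * I)) := by
        congr 1
        funext θ
        refine hgΩ _ (hsub ?_)
        simp [Complex.norm_exp_ofReal_mul_I, abs_of_pos hr]
      rw [heq]
      rwa [one_div, inv_mul_le_iff₀ Real.two_pi_pos] at hmv
    rw [lapC_sub_const_mul hf hρ]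
    have h2 := mul_le_mul_of_nonneg_left (hρl z hzΩ) (div_pos hε hM).le
    linarith

/-! ### The decay estimate -/

theorem le_add_of_infDist_lt {Ω : Set ℂ} (hΩo : IsOpen Ω) (hne : Ωᶜ.Nonempty) {φ ψ : ℂ → ℝ}
    (hbd : ∀ z ∈ frontier Ω, φ z ≤ ψ z) {δ ε : ℝ}
    (hφ : ∀ z w, dist z w < δ → |φ z - φ w| ≤ ε)
    (hψ : ∀ z ∈ closure Ω, ∀ w ∈ closure Ω, dist z w < δ → |ψ z - ψ w| ≤ ε)
    {z : ℂ} (hz : z ∈ Ω) (hzδ : Metric.infDist z Ωᶜ < δ) : φ z ≤ ψ z + 2 * ε := by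
  obtain ⟨y, hy, hyd⟩ := hΩo.isClosed_compl.exists_infDist_eq_dist hne z
  have hzy : dist z y < δ := hyd ▸ hzδ
  have hne0 : dist z y ≠ 0 := fun h0 => hy (dist_eq_zero.1 h0 ▸ hz)
  have hball : Metric.ball z (dist z y) ⊆ Ω := fun w hw => by
    by_contra hn
    have h1 := Metric.infDist_le_dist_of_mem (x := z) (show w ∈ Ωᶜ from hn)
    rw [Metric.mem_ball, dist_comm] at hw
    linarith
  have hycl : y ∈ closure Ω := by
    refine closure_mono hball ?_
    rw [closure_ball z hne0, Metric.mem_closedBall, dist_comm]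
  have h0 := hbd y (hΩo.frontier_eq ▸ ⟨hycl, hy⟩)
  have h1 := (abs_le.1 (hφ z y hzy)).2
  have h2 := (abs_le.1 (hψ z (subset_closure hz) y hycl hzy)).1
  linarith

theorem exp_weight_le {a b s h : ℝ} (hh : 0 < h) (hab : a ≤ b + s) :
    Real.exp (-2 * b / h) ≤ Real.exp (2 * s / h) * Real.exp (-2 * a / h) := by
  rw [← Real.exp_add, ← add_div]
  gcongr
  linarith

theorem dbar_ofReal_mul {χ : ℂ → ℝ} {u : ℂ → ℂ} (hχ : ContDiff ℝ (⊤ : ℕ∞) χ)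
    (hu : ContDiff ℝ (⊤ : ℕ∞) u) (z : ℂ) :
    dbar (fun w => (χ w : ℂ) * u w) z =
      χ z * dbar u z + u z * (((fderiv ℝ χ z 1 : ℝ) + I * (fderiv ℝ χ z I : ℝ)) / 2) := by
  have hu' := (hu.differentiable (by simp) z).hasFDerivAt
  have hχ' := (hχ.differentiable (by simp) z).hasFDerivAt
  have key : ∀ a : ℂ, fderiv ℝ (fun w => (χ w : ℂ) * u w) z a =
      χ z * fderiv ℝ u z a + u z * (fderiv ℝ χ z a : ℝ) := fun a => by
    have h := DFunLike.congr_fun (((Complex.ofRealCLM.hasFDerivAt.comp z hχ').mul hu').fderiv) a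
    have he : ⇑Complex.ofRealCLM ∘ χ * u = fun w => (χ w : ℂ) * u w := rfl
    rw [he] at h
    simpa using h
  simp only [dbar, key]
  ring

theorem fderiv_eq_zero_of_mem_Icc {χ : ℂ → ℝ} (h01 : ∀ z, χ z ∈ Set.Icc 0 1) {z : ℂ}
    (hz : χ z = 0 ∨ χ z = 1) : fderiv ℝ χ z = 0 := by
  rcases hz with hz | hz
  · exact IsLocalMin.fderiv_eq_zero (Filter.Eventually.of_forall fun w => hz ▸ (h01 w).1)
  · exact IsLocalMax.fderiv_eq_zero (Filter.Eventually.of_forall fun w => hz ▸ (h01 w).2)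

theorem integrableOn_weighted {w : ℂ → ℂ} (hw : Continuous w) {Φ : ℂ → ℝ} (hΦ : Continuous Φ)
    (h : ℝ) : IntegrableOn (fun z => ‖w z‖ ^ 2 * Real.exp (-2 * Φ z / h)) Efd :=
  Continuous.integrableOn_Efd (by fun_prop)

theorem continuous_dbar {u : ℂ → ℂ} (hu : ContDiff ℝ (⊤ : ℕ∞) u) : Continuous (dbar u) := by
  have h := hu.continuous_fderiv (by simp)
  unfold dbar
  fun_prop

/-- Weighted `L²` bound for `∂̄` of a cut-off function, where the cutoff lives on a region where
`Φ - τ` is almost below `Ψ` and varies only where `Φ` is almost below `Ψ`. -/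
theorem wInt_dbar_cutoff_le {φ Ψ χ : ℂ → ℝ} (hφ : Continuous φ)
    (hχ : ContDiff ℝ (⊤ : ℕ∞) χ) (h01 : ∀ z, χ z ∈ Set.Icc 0 1) {τ ε B : ℝ} (hε : 0 < ε)
    (hB : ∀ z, ‖((fderiv ℝ χ z 1 : ℝ) + I * (fderiv ℝ χ z I : ℝ) : ℂ) / 2‖ ≤ B)
    (hΨ : ∀ z, χ z ≠ 0 → φ z ≤ Ψ z + (τ + 2 * ε))
    (hΨ' : ∀ z, χ z ≠ 0 → χ z ≠ 1 → φ z ≤ Ψ z + 4 * ε)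
    {h : ℝ} (hh : 0 < h) (hh1 : h ≤ 1) {u : ℂ → ℂ} (hu : ContDiff ℝ (⊤ : ℕ∞) u)
    (hu1 : wInt φ h u ≤ 1)
    (hu2 : wInt φ h (fun z => (h : ℂ) * dbar u z) ≤ Real.exp (-2 * τ / h)) :
    wInt Ψ h (fun z => (h : ℂ) * dbar (fun w => (χ w : ℂ) * u w) z) ≤
      2 * (1 + B ^ 2) * Real.exp (8 * ε / h) := by
  have i1 := integrableOn_weighted (w := fun z => (h : ℂ) * dbar u z)
    (continuous_const.mul (continuous_dbar hu)) hφ h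
  have i2 := integrableOn_weighted hu.continuous hφ h
  have hpt : ∀ z, ‖(h : ℂ) * dbar (fun w => (χ w : ℂ) * u w) z‖ ^ 2 * Real.exp (-2 * Ψ z / h) ≤
      2 * Real.exp (2 * (τ + 2 * ε) / h) *
        (‖(h : ℂ) * dbar u z‖ ^ 2 * Real.exp (-2 * φ z / h)) +
      2 * B ^ 2 * Real.exp (2 * (4 * ε) / h) * (‖u z‖ ^ 2 * Real.exp (-2 * φ z / h)) := by
    intro z
    rw [dbar_ofReal_mul hχ hu]
    set k : ℂ := ((fderiv ℝ χ z 1 : ℝ) + I * (fderiv ℝ χ z I : ℝ) : ℂ) / 2 with hk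
    have hk0 : χ z = 0 ∨ χ z = 1 → k = 0 := fun h0 => by
      rw [hk, fderiv_eq_zero_of_mem_Icc h01 h0]
      simp
    by_cases h0 : χ z = 0
    · rw [hk0 (Or.inl h0), h0]
      simp only [ofReal_zero, zero_mul, mul_zero, add_zero, norm_zero]
      rw [zero_pow two_ne_zero, zero_mul]
      positivity
    have hsq : ‖(h : ℂ) * (χ z * dbar u z + u z * k)‖ ^ 2 ≤
        2 * ‖(h : ℂ) * dbar u z‖ ^ 2 + 2 * (‖k‖ ^ 2 * ‖u z‖ ^ 2) := by
      have hn : ‖(h : ℂ) * (χ z * dbar u z + u z * k)‖ ≤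
          ‖(h : ℂ) * dbar u z‖ + ‖k‖ * ‖u z‖ := by
        rw [norm_mul, norm_mul, Complex.norm_of_nonneg hh.le]
        have t1 : ‖(χ z : ℂ) * dbar u z‖ ≤ ‖dbar u z‖ := by
          rw [norm_mul, Complex.norm_of_nonneg (h01 z).1]
          exact mul_le_of_le_one_left (norm_nonneg _) (h01 z).2
        have t2 : h * (‖k‖ * ‖u z‖) ≤ ‖k‖ * ‖u z‖ := mul_le_of_le_one_left (by positivity) hh1
        have t3 : ‖(χ z : ℂ) * dbar u z + u z * k‖ ≤ ‖dbar u z‖ + ‖k‖ * ‖u z‖ := by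
          refine (norm_add_le _ _).trans (add_le_add t1 ?_)
          rw [norm_mul, mul_comm]
        linarith [mul_le_mul_of_nonneg_left t3 hh.le]
      have := pow_le_pow_left₀ (norm_nonneg _) hn 2
      nlinarith [sq_nonneg (‖(h : ℂ) * dbar u z‖ - ‖k‖ * ‖u z‖)]
    have e1 := exp_weight_le hh (hΨ z h0)
    have e2 : ‖k‖ ^ 2 * Real.exp (-2 * Ψ z / h) ≤
        B ^ 2 * (Real.exp (2 * (4 * ε) / h) * Real.exp (-2 * φ z / h)) := by
      by_cases h1 : χ z = 1
      · rw [hk0 (Or.inr h1), norm_zero, zero_pow two_ne_zero, zero_mul]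
        positivity
      · have := exp_weight_le hh (hΨ' z h0 h1)
        gcongr
        exact hB z
    calc _ ≤ (2 * ‖(h : ℂ) * dbar u z‖ ^ 2 + 2 * (‖k‖ ^ 2 * ‖u z‖ ^ 2)) *
            Real.exp (-2 * Ψ z / h) := by gcongr
      _ = 2 * ‖(h : ℂ) * dbar u z‖ ^ 2 * Real.exp (-2 * Ψ z / h) +
            2 * ‖u z‖ ^ 2 * (‖k‖ ^ 2 * Real.exp (-2 * Ψ z / h)) := by ring
      _ ≤ 2 * ‖(h : ℂ) * dbar u z‖ ^ 2 *
              (Real.exp (2 * (τ + 2 * ε) / h) * Real.exp (-2 * φ z / h)) +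
            2 * ‖u z‖ ^ 2 *
              (B ^ 2 * (Real.exp (2 * (4 * ε) / h) * Real.exp (-2 * φ z / h))) := by gcongr
      _ = _ := by ring
  calc _ ≤ ∫ z in Efd, (2 * Real.exp (2 * (τ + 2 * ε) / h) *
            (‖(h : ℂ) * dbar u z‖ ^ 2 * Real.exp (-2 * φ z / h)) +
          2 * B ^ 2 * Real.exp (2 * (4 * ε) / h) *
            (‖u z‖ ^ 2 * Real.exp (-2 * φ z / h))) := by
        refine integral_mono_of_nonneg (Filter.Eventually.of_forall fun z => by positivity)
          (Integrable.add (i1.const_mul _) (i2.const_mul _)) (Filter.Eventually.of_forall hpt)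
    _ = 2 * Real.exp (2 * (τ + 2 * ε) / h) * wInt φ h (fun z => (h : ℂ) * dbar u z) +
          2 * B ^ 2 * Real.exp (2 * (4 * ε) / h) * wInt φ h u := by
        rw [integral_add (i1.const_mul _) (i2.const_mul _), integral_const_mul,
          integral_const_mul]
        rfl
    _ ≤ 2 * Real.exp (2 * (τ + 2 * ε) / h) * Real.exp (-2 * τ / h) +
          2 * B ^ 2 * Real.exp (2 * (4 * ε) / h) * 1 := by gcongr
    _ = 2 * Real.exp (4 * ε / h) + 2 * B ^ 2 * Real.exp (8 * ε / h) := by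
        rw [mul_assoc, ← Real.exp_add]
        ring_nf
    _ ≤ 2 * Real.exp (8 * ε / h) + 2 * B ^ 2 * Real.exp (8 * ε / h) := by
        gcongr
        linarith
    _ = _ := by ring

/-- **Proposition (exponential decay of approximate singular states in the classically
forbidden region).** -/
theorem decay_in_forbidden_region
    (φ : ℂ → ℝ) (hφ : ContDiff ℝ (⊤ : ℕ∞) φ) (hφp : PeriodicC φ) (hφnc : ∃ z w : ℂ, φ z ≠ φ w)
    (Ω : Set ℂ) (hΩo : IsOpen Ω) (hΩper : PeriodicSet Ω)
    (hext : (interior Ωᶜ).Nonempty)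
    (ψ : ℂ → ℝ) (hψc : ContinuousOn ψ (closure Ω)) (hψp : PeriodicC ψ)
    (hψsh : SuperharmonicMV ψ Ω)
    (τ : ℝ) (hτ0 : 0 < τ) (hτ : τ < sSup (φ '' Efd) - sInf (φ '' Efd))
    (hbd1 : ∀ z ∈ frontier Ω, φ z ≤ ψ z)
    (hbd2 : ∀ z ∈ closure Ω, φ z - τ ≤ ψ z) :
    ∀ ε > 0, ∃ C > 0, ∀ h : ℝ, 0 < h → h ≤ 1 →
      ∀ u : ℂ → ℂ, ContDiff ℝ (⊤ : ℕ∞) u → PeriodicC u →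
        wInt φ h u ≤ 1 →
        wInt φ h (fun z => (h : ℂ) * dbar u z) ≤ Real.exp (-2 * τ / h) →
        (∫ z in Ω ∩ Efd, ‖u z‖ ^ 2 * Real.exp (-2 * ψ z / h)) ≤
          C ^ 2 * Real.exp (2 * ε / h) := by
  intro ε₀ hε₀
  obtain ⟨ε, hε, rfl⟩ : ∃ ε > 0, ε₀ = 10 * ε := ⟨ε₀ / 10, by positivity, by ring⟩
  obtain ⟨δ₁, hδ₁, hψδ⟩ :=
    PeriodicC.exists_dist_le hΩper.closure isClosed_closure hψp hψc hε
  obtain ⟨δ₂, hδ₂, hφδ⟩ := PeriodicC.exists_dist_le (S := Set.univ)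
    (fun z => ⟨Iff.rfl, Iff.rfl⟩) isClosed_univ hφp hφ.continuous.continuousOn hε
  obtain ⟨δ, hδ, hδ1, hδ2⟩ : ∃ δ > 0, 4 * δ ≤ δ₁ ∧ 4 * δ ≤ δ₂ :=
    ⟨min δ₁ δ₂ / 4, by positivity, by linarith [min_le_left δ₁ δ₂],
      by linarith [min_le_right δ₁ δ₂]⟩
  have hψδ' : ∀ z ∈ closure Ω, ∀ w ∈ closure Ω, dist z w < 4 * δ → |ψ z - ψ w| ≤ ε :=
    fun z hz w hw hd => hψδ z hz w hw (hd.trans_le hδ1)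
  have hφδ' : ∀ z w, dist z w < 4 * δ → |φ z - φ w| ≤ ε :=
    fun z w hd => hφδ z trivial w trivial (hd.trans_le hδ2)
  have hmem : ∀ z, 2 * δ ≤ Metric.infDist z Ωᶜ → z ∈ Ω := fun z hz => by
    by_contra hn
    linarith [Metric.infDist_zero_of_mem (show z ∈ Ωᶜ from hn)]
  have hnear : ∀ z ∈ Ω, Metric.infDist z Ωᶜ < 4 * δ → φ z ≤ ψ z + 2 * ε := fun z hz hd =>
    le_add_of_infDist_lt hΩo (hext.mono interior_subset) hbd1 hφδ' hψδ' hz hd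
  obtain ⟨Ψ, c, hc, hΨ, hΨp, hΨb⟩ := exists_smooth_weight hΩo hΩper hext hψc hψp hψsh hδ hε
    fun z hz w hw hd => hψδ' z hz w hw (hd.trans (by linarith))
  obtain ⟨χ, hχ, hχp, h01, hχ0, hχ1⟩ := exists_cutoff hΩper.compl hδ
  obtain ⟨B, hB⟩ : ∃ B, ∀ z,
      ‖((fderiv ℝ χ z 1 : ℝ) + I * (fderiv ℝ χ z I : ℝ) : ℂ) / 2‖ ≤ B := by
    have hcont := hχ.continuous_fderiv (by simp)
    obtain ⟨B, hB⟩ := PeriodicC.exists_norm_le (S := Set.univ) (fun z => ⟨Iff.rfl, Iff.rfl⟩)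
      isClosed_univ (hχp.fderiv.map fun L => ((L 1 : ℝ) + I * (L I : ℝ) : ℂ) / 2)
      (by fun_prop)
    exact ⟨B, fun z => hB z trivial⟩
  set K : ℝ := 4 * (1 + B ^ 2) / (c * ε) with hK
  have hK0 : 0 < K := by positivity
  refine ⟨√(1 + K), by positivity, fun h hh hh1 u hu hup hu1 hu2 => ?_⟩
  rw [Real.sq_sqrt (by positivity)]
  set v : ℂ → ℂ := fun z => (χ z : ℂ) * u z with hv
  have hvs : ContDiff ℝ (⊤ : ℕ∞) v := (Complex.ofRealCLM.contDiff.comp hχ).mul hu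
  have hv0 : ∀ z, v z ≠ 0 → χ z ≠ 0 := fun z hz h0 => hz (by simp [hv, h0])
  have hdb := wInt_dbar_cutoff_le (Ψ := Ψ) hφ.continuous hχ h01 hε hB
    (fun z hz => by
      have h2 := hχ0 z hz
      linarith [(abs_le.1 (hΨb z h2).1).1, hbd2 z (subset_closure (hmem z h2))])
    (fun z hz hz1 => by
      have h2 := hχ0 z hz
      have h4 := not_le.1 (mt (hχ1 z) hz1)
      linarith [(abs_le.1 (hΨb z h2).1).1, hnear z (hmem z h2) h4]) hh hh1 hu hu1 hu2
  have hvb : wInt Ψ h v ≤ K * Real.exp (9 * ε / h) := by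
    have hest := (weighted_dbar_estimate hvs (hχp.map₂ hup fun x y => (x : ℂ) * y) hΨ hΨp hh
      fun z hz => (hΨb z (hχ0 z (hv0 z hz))).2).trans hdb
    have hexp : ε / h ≤ Real.exp (ε / h) := by linarith [Real.add_one_le_exp (ε / h)]
    have hsplit : Real.exp (9 * ε / h) = Real.exp (8 * ε / h) * Real.exp (ε / h) := by
      rw [← Real.exp_add]
      ring_nf
    calc wInt Ψ h v = 2 / (h * c) * (h / 2 * c * wInt Ψ h v) := by field_simp
      _ ≤ 2 / (h * c) * (2 * (1 + B ^ 2) * Real.exp (8 * ε / h)) := by gcongr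
      _ = K * Real.exp (8 * ε / h) * (ε / h) := by
        rw [hK]
        field_simp
        ring
      _ ≤ K * Real.exp (8 * ε / h) * Real.exp (ε / h) := by gcongr
      _ = K * Real.exp (9 * ε / h) := by rw [hsplit, mul_assoc]
  have i1 := integrableOn_weighted hu.continuous hφ.continuous h
  have i2 := integrableOn_weighted hvs.continuous hΨ.continuous h
  have hpt : ∀ z ∈ Ω, ‖u z‖ ^ 2 * Real.exp (-2 * ψ z / h) ≤ Real.exp (2 * (2 * ε) / h) *
      (‖u z‖ ^ 2 * Real.exp (-2 * φ z / h) + ‖v z‖ ^ 2 * Real.exp (-2 * Ψ z / h)) := by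
    intro z hz
    rw [mul_add]
    rcases lt_or_ge (Metric.infDist z Ωᶜ) (4 * δ) with hd | hd
    · refine le_add_of_le_of_nonneg ?_ (by positivity)
      rw [mul_left_comm]
      exact mul_le_mul_of_nonneg_left (exp_weight_le hh (hnear z hz hd)) (by positivity)
    · refine le_add_of_nonneg_of_le (by positivity) ?_
      have huv : v z = u z := by simp [hv, hχ1 z hd]
      rw [huv, mul_left_comm]
      refine mul_le_mul_of_nonneg_left (exp_weight_le hh ?_) (by positivity)
      linarith [(abs_le.1 (hΨb z (by linarith)).1).2]
  have i3 : IntegrableOn (fun z => Real.exp (2 * (2 * ε) / h) *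
      (‖u z‖ ^ 2 * Real.exp (-2 * φ z / h) + ‖v z‖ ^ 2 * Real.exp (-2 * Ψ z / h))) Efd :=
    (Integrable.add i1 i2).const_mul _
  calc _ ≤ ∫ z in Ω ∩ Efd, Real.exp (2 * (2 * ε) / h) *
          (‖u z‖ ^ 2 * Real.exp (-2 * φ z / h) + ‖v z‖ ^ 2 * Real.exp (-2 * Ψ z / h)) :=
        integral_mono_of_nonneg (Filter.Eventually.of_forall fun z => by positivity)
          (i3.mono_set Set.inter_subset_right)
          ((ae_restrict_mem (hΩo.measurableSet.inter measurableSet_Efd)).mono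
            fun z hz => hpt z hz.1)
    _ ≤ ∫ z in Efd, Real.exp (2 * (2 * ε) / h) *
          (‖u z‖ ^ 2 * Real.exp (-2 * φ z / h) + ‖v z‖ ^ 2 * Real.exp (-2 * Ψ z / h)) :=
        setIntegral_mono_set i3 (Filter.Eventually.of_forall fun z => by positivity)
          (Set.inter_subset_right : Ω ∩ Efd ⊆ Efd).eventuallyLE
    _ = Real.exp (2 * (2 * ε) / h) * (wInt φ h u + wInt Ψ h v) := by
        rw [integral_const_mul, integral_add i1 i2]
        rfl
    _ ≤ Real.exp (2 * (2 * ε) / h) *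
          (1 * Real.exp (9 * ε / h) + K * Real.exp (9 * ε / h)) := by
        have h1 : 1 ≤ Real.exp (9 * ε / h) := Real.one_le_exp (by positivity)
        gcongr
        linarith
    _ = (1 + K) * Real.exp (13 * ε / h) := by
        rw [← add_mul, mul_left_comm, ← Real.exp_add]
        ring_nf
    _ ≤ (1 + K) * Real.exp (2 * (10 * ε) / h) := by
        gcongr (1 + K) * Real.exp (?_ / h)
        linarith
end
end

section
/- (Weighted Cauchy estimates for holomorphic functions.) Let Ω ⊆ ℂⁿ be open and let φ : Ω → ℝ be locally Lipschitz continuous. For each compact set K ⊆ Ω, each open set ω with K ⊆ ω and closure(ω) compact and contained in Ω, and each multi-index α ∈ ℕⁿ, there is a constant C_α > 0 such that for all h ∈ (0,1] and all holomorphic functions f : Ω → ℂ: ∫_K |h^{|α|} ∂^α f(z)|² e^{−2φ(z)/h} L(dz) ≤ C_α² ∫_ω |f(z)|² e^{−2φ(z)/h} L(dz), where ∂^α denotes the complex partial derivative ∂^{α₁}_{z₁}⋯∂^{αₙ}_{zₙ}. -/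
open MeasureTheory Real Complex

noncomputable section

/-- The complex partial derivative `∂_{z_j}`. -/
noncomputable def pderiv' {n : ℕ} (j : Fin n) (f : (Fin n → ℂ) → ℂ) :
    (Fin n → ℂ) → ℂ :=
  fun z => fderiv ℂ f z (Pi.single j 1)

/-- The iterated complex partial derivative `∂^α = ∂_{z₁}^{α₁} ⋯ ∂_{zₙ}^{αₙ}`. -/
noncomputable def mderiv {n : ℕ} (α : Fin n → ℕ) (f : (Fin n → ℂ) → ℂ) :
    (Fin n → ℂ) → ℂ :=
  (((List.finRange n).map fun j => (pderiv' j)^[α j]).foldr (· ∘ ·) id) f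

section CauchyFormula

variable {E : Type*} [NormedAddCommGroup E] [NormedSpace ℂ E]

/-- Cauchy's integral formula for a directional derivative. -/
theorem fderiv_apply_eq_setIntegral_circleMap {f : E → ℂ} {z v : E} {r : ℝ} (hr : 0 < r)
    (hf : ∀ w : ℂ, ‖w‖ ≤ r → DifferentiableAt ℂ f (z + w • v)) :
    fderiv ℂ f z v = (2 * π : ℂ)⁻¹ *
      ∫ θ in Set.Icc 0 (2 * π), (circleMap 0 r θ)⁻¹ * f (z + circleMap 0 r θ • v) := by
  have hline : ∀ w : ℂ, HasDerivAt (fun w : ℂ => z + w • v) v w := fun w => by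
    simpa using ((hasDerivAt_id w).smul_const v).const_add z
  have hd : DifferentiableOn ℂ (fun w : ℂ => f (z + w • v)) (Metric.closedBall 0 r) := by
    intro w hw
    exact ((hf w (by simpa using hw)).comp w
      (hline w).differentiableAt).differentiableWithinAt
  have hderiv : deriv (fun w : ℂ => f (z + w • v)) 0 = fderiv ℂ f z v := by
    have h0 : DifferentiableAt ℂ f (z + (0 : ℂ) • v) := hf 0 (by simpa using hr.le)
    have h1 := h0.hasFDerivAt.comp_hasDerivAt (0 : ℂ) (hline 0)
    simpa [Function.comp_def] using h1.deriv
  have key := hd.deriv_eq_smul_circleIntegral hr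
  rw [hderiv, circleIntegral_def_Icc] at key
  have hI : ∀ θ : ℝ, deriv (circleMap 0 r) θ • (1 / (circleMap 0 r θ - 0) ^ 2) •
      f (z + circleMap 0 r θ • v) =
      I * ((circleMap 0 r θ)⁻¹ * f (z + circleMap 0 r θ • v)) := fun θ => by
    have : circleMap 0 r θ ≠ 0 := circleMap_ne_center hr.ne'
    simp only [deriv_circleMap, smul_eq_mul, sub_zero]
    field_simp
  simp only [hI] at key
  rw [integral_const_mul, smul_eq_mul] at key
  have hpi : (π : ℂ) ≠ 0 := by exact_mod_cast Real.pi_ne_zero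
  have key' : ∫ θ in Set.Icc 0 (2 * π), (circleMap 0 r θ)⁻¹ * f (z + circleMap 0 r θ • v) =
      2 * π * fderiv ℂ f z v := by
    apply mul_left_cancel₀ I_ne_zero
    rw [key]
    ring
  rw [key']
  field_simp

theorem sq_setIntegral_le_mul_setIntegral_sq {u : ℝ → ℝ} {a b : ℝ} (hab : a < b)
    (hu : ContinuousOn u (Set.Icc a b)) :
    (∫ θ in Set.Icc a b, u θ) ^ 2 ≤ (b - a) * ∫ θ in Set.Icc a b, u θ ^ 2 := by
  set A := ∫ θ in Set.Icc a b, u θ with hA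
  have hpos : 0 < b - a := sub_pos.2 hab
  set t := A / (b - a) with ht
  have h1 : 0 ≤ ∫ θ in Set.Icc a b, (u θ - t) ^ 2 := integral_nonneg fun θ => sq_nonneg _
  have hi2 : IntegrableOn (fun θ => u θ ^ 2) (Set.Icc a b) := (hu.pow 2).integrableOn_Icc
  have hi1 : IntegrableOn (fun θ => 2 * t * u θ) (Set.Icc a b) :=
    (hu.const_mul (2 * t)).integrableOn_Icc
  have hi0 : IntegrableOn (fun _ : ℝ => t ^ 2) (Set.Icc a b) :=
    continuousOn_const.integrableOn_Icc
  have h2 : ∫ θ in Set.Icc a b, (u θ - t) ^ 2 =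
      (∫ θ in Set.Icc a b, u θ ^ 2) - 2 * t * A + (b - a) * t ^ 2 := by
    have : ∀ θ, (u θ - t) ^ 2 = u θ ^ 2 - 2 * t * u θ + t ^ 2 := fun θ => by ring
    simp only [this]
    rw [integral_add (by exact hi2.sub hi1) hi0, integral_sub hi2 hi1, integral_const_mul]
    simp [hpos.le, ← hA]
  rw [h2] at h1
  have h3 : t * (b - a) = A := by rw [ht]; field_simp
  have h4 := mul_nonneg hpos.le h1
  rw [← h3] at h4 ⊢
  nlinarith

/-- The `L²` form of Cauchy's estimate for a directional derivative. -/
theorem norm_fderiv_apply_sq_le_setIntegral_circleMap {f : E → ℂ} {z v : E} {r : ℝ} (hr : 0 < r)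
    (hf : ∀ w : ℂ, ‖w‖ ≤ r → DifferentiableAt ℂ f (z + w • v)) :
    ‖fderiv ℂ f z v‖ ^ 2 ≤ (r ^ 2)⁻¹ * ((2 * π)⁻¹ *
      ∫ θ in Set.Icc 0 (2 * π), ‖f (z + circleMap 0 r θ • v)‖ ^ 2) := by
  have hcont : ContinuousOn (fun θ => ‖f (z + circleMap 0 r θ • v)‖) (Set.Icc 0 (2 * π)) := by
    intro θ _
    have h1 : ContinuousAt f (z + circleMap 0 r θ • v) :=
      (hf _ (by simp [abs_of_pos hr])).continuousAt
    have h2 : ContinuousAt (fun θ => z + circleMap 0 r θ • v) θ := by fun_prop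
    exact (ContinuousAt.comp (f := fun θ => z + circleMap 0 r θ • v) h1
      h2).norm.continuousWithinAt
  have hsq := sq_setIntegral_le_mul_setIntegral_sq Real.two_pi_pos hcont
  rw [sub_zero] at hsq
  have hnorm : ‖fderiv ℂ f z v‖ ≤ (2 * π)⁻¹ * (r⁻¹ *
      ∫ θ in Set.Icc 0 (2 * π), ‖f (z + circleMap 0 r θ • v)‖) := by
    rw [fderiv_apply_eq_setIntegral_circleMap hr hf, norm_mul, ← integral_const_mul]
    have hpi : ‖(2 * π : ℂ)⁻¹‖ = (2 * π)⁻¹ := by simp [abs_of_pos Real.pi_pos]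
    rw [hpi]
    refine mul_le_mul_of_nonneg_left ?_ (by positivity)
    refine (norm_integral_le_integral_norm _).trans_eq ?_
    simp [abs_of_pos hr]
  calc ‖fderiv ℂ f z v‖ ^ 2 ≤ ((2 * π)⁻¹ * (r⁻¹ *
        ∫ θ in Set.Icc 0 (2 * π), ‖f (z + circleMap 0 r θ • v)‖)) ^ 2 := by gcongr
    _ = (r ^ 2)⁻¹ * ((2 * π)⁻¹ * ((2 * π)⁻¹ *
        (∫ θ in Set.Icc 0 (2 * π), ‖f (z + circleMap 0 r θ • v)‖) ^ 2)) := by ring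
    _ ≤ (r ^ 2)⁻¹ * ((2 * π)⁻¹ * ((2 * π)⁻¹ *
        (2 * π * ∫ θ in Set.Icc 0 (2 * π), ‖f (z + circleMap 0 r θ • v)‖ ^ 2))) := by gcongr
    _ = _ := by
      have := Real.pi_pos
      field_simp

/-- Directional derivatives of a holomorphic function are holomorphic. -/
theorem DifferentiableOn.fderiv_apply_const_of_isOpen [FiniteDimensional ℂ E]
    {f : E → ℂ} {Ω : Set E} (hΩ : IsOpen Ω) (hf : DifferentiableOn ℂ f Ω) (v : E) :
    DifferentiableOn ℂ (fun z => fderiv ℂ f z v) Ω := by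
  intro x₀ hx₀
  borelize E
  have hfd : ∀ y ∈ Ω, DifferentiableAt ℂ f y := fun y hy => hf.differentiableAt (hΩ.mem_nhds hy)
  obtain ⟨ρ, hρ, hball⟩ : ∃ ρ > 0, ∀ y ∈ Metric.ball x₀ ρ, y ∈ Ω ∧ f y ∈ Metric.ball (f x₀) 1 :=
    Metric.eventually_nhds_iff_ball.1 ((hΩ.eventually_mem hx₀).and
      ((hfd x₀ hx₀).continuousAt.eventually (Metric.ball_mem_nhds _ one_pos)))
  have hbound : ∀ y ∈ Metric.ball x₀ (ρ / 2), ‖fderiv ℂ f y‖ ≤ 2 / (ρ / 2) := by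
    intro y hy
    have hsub : Metric.ball y (ρ / 2) ⊆ Metric.ball x₀ ρ :=
      Metric.ball_subset_ball' (by linarith [Metric.mem_ball.1 hy])
    refine norm_fderiv_le_div_of_mapsTo_ball
      (hf.mono fun x hx => (hball x (hsub hx)).1) (fun x hx => ?_) (half_pos hρ)
    have h1 := (hball x (hsub hx)).2
    have h2 := (hball y (hsub (Metric.mem_ball_self (half_pos hρ)))).2
    rw [Metric.mem_ball] at h1 h2
    rw [Metric.mem_closedBall]
    linarith [dist_triangle_right (f x) (f y) (f x₀)]
  set r : ℝ := ρ / (4 * (‖v‖ + 1)) with hr_def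
  have hr : 0 < r := by positivity
  have hrv : r * ‖v‖ ≤ ρ / 4 := by
    rw [hr_def, div_mul_eq_mul_div, div_le_div_iff₀ (by positivity) (by positivity)]
    nlinarith [norm_nonneg v]
  have hmem : ∀ x ∈ Metric.ball x₀ (ρ / 4), ∀ w : ℂ, ‖w‖ ≤ r →
      x + w • v ∈ Metric.ball x₀ (ρ / 2) := by
    intro x hx w hw
    rw [Metric.mem_ball, dist_eq_norm] at hx ⊢
    have : ‖w • v‖ ≤ ρ / 4 := by
      rw [norm_smul]
      exact (mul_le_mul_of_nonneg_right hw (norm_nonneg v)).trans hrv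
    calc ‖x + w • v - x₀‖ = ‖(x - x₀) + w • v‖ := by congr 1; abel
      _ ≤ ‖x - x₀‖ + ‖w • v‖ := norm_add_le _ _
      _ < ρ / 2 := by linarith
  have hdiff : ∀ x ∈ Metric.ball x₀ (ρ / 4), ∀ w : ℂ, ‖w‖ ≤ r →
      DifferentiableAt ℂ f (x + w • v) := fun x hx w hw =>
    hfd _ (hball _ (Metric.ball_subset_ball (by linarith) (hmem x hx w hw))).1
  have hcircle : ∀ θ : ℝ, ‖circleMap 0 r θ‖ ≤ r := fun θ => by simp [abs_of_pos hr]
  have hne : ∀ θ : ℝ, circleMap 0 r θ ≠ 0 := fun θ => circleMap_ne_center hr.ne'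
  have hcont : ∀ x ∈ Metric.ball x₀ (ρ / 4),
      Continuous fun θ : ℝ => (circleMap 0 r θ)⁻¹ * f (x + circleMap 0 r θ • v) := by
    intro x hx
    refine ((continuous_circleMap 0 r).inv₀ hne).mul (continuous_iff_continuousAt.2 fun θ => ?_)
    exact ContinuousAt.comp (f := fun θ => x + circleMap 0 r θ • v)
      (hdiff x hx _ (hcircle θ)).continuousAt (by fun_prop)
  have hx₀mem : x₀ ∈ Metric.ball x₀ (ρ / 4) := Metric.mem_ball_self (by positivity)
  have hnhds : Metric.ball x₀ (ρ / 4) ∈ nhds x₀ := Metric.ball_mem_nhds _ (by positivity)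
  have hint : HasFDerivAt (fun x => ∫ θ in Set.Icc 0 (2 * π),
      (circleMap 0 r θ)⁻¹ * f (x + circleMap 0 r θ • v))
      (∫ θ in Set.Icc 0 (2 * π),
        (circleMap 0 r θ)⁻¹ • fderiv ℂ f (x₀ + circleMap 0 r θ • v)) x₀ := by
    refine hasFDerivAt_integral_of_dominated_of_fderiv_le
      (F' := fun x θ => (circleMap 0 r θ)⁻¹ • fderiv ℂ f (x + circleMap 0 r θ • v))
      (bound := fun _ => r⁻¹ * (2 / (ρ / 2))) hnhds ?_ ?_ ?_ ?_ ?_ ?_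
    · filter_upwards [hnhds] with x hx using (hcont x hx).aestronglyMeasurable
    · exact (hcont x₀ hx₀mem).continuousOn.integrableOn_Icc
    · refine ((continuous_circleMap 0 r).inv₀ hne).aestronglyMeasurable.smul ?_
      have : Continuous fun θ : ℝ => x₀ + circleMap 0 r θ • v := by fun_prop
      exact ((measurable_fderiv ℂ f).comp this.measurable).aestronglyMeasurable
    · refine Filter.Eventually.of_forall fun θ x hx => ?_
      rw [norm_smul, norm_inv, norm_circleMap_zero, abs_of_pos hr]
      gcongr
      exact hbound _ (hmem x hx _ (hcircle θ))
    · exact continuousOn_const.integrableOn_Icc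
    · refine Filter.Eventually.of_forall fun θ x hx => ?_
      exact ((hasFDerivAt_comp_add_right _).2 (hdiff x hx _ (hcircle θ)).hasFDerivAt).const_mul _
  have heq : (fun z => fderiv ℂ f z v) =ᶠ[nhds x₀] fun x => (2 * π : ℂ)⁻¹ *
      ∫ θ in Set.Icc 0 (2 * π), (circleMap 0 r θ)⁻¹ * f (x + circleMap 0 r θ • v) := by
    filter_upwards [hnhds] with x hx using fderiv_apply_eq_setIntegral_circleMap hr (hdiff x hx)
  exact ((hint.differentiableAt.const_mul _).congr_of_eventuallyEq heq).differentiableWithinAt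

end CauchyFormula

section WeightedEstimates

variable {n : ℕ} {Ω : Set (Fin n → ℂ)} {φ : (Fin n → ℂ) → ℝ}

theorem DifferentiableOn.pderiv' (hΩ : IsOpen Ω) {f : (Fin n → ℂ) → ℂ}
    (hf : DifferentiableOn ℂ f Ω) (j : Fin n) : DifferentiableOn ℂ (pderiv' j f) Ω :=
  hf.fderiv_apply_const_of_isOpen hΩ _

theorem continuousOn_of_forall_lipschitzOnWith_ball_inter
    (hφ : ∀ x ∈ Ω, ∃ (K : NNReal) (δ : ℝ), 0 < δ ∧
      LipschitzOnWith K φ (Metric.ball x δ ∩ Ω)) : ContinuousOn φ Ω := by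
  intro x hx
  obtain ⟨K, δ, hδ, hL⟩ := hφ x hx
  refine (hL.continuousOn x ⟨Metric.mem_ball_self hδ, hx⟩).mono_of_mem_nhdsWithin ?_
  exact Filter.inter_mem (mem_nhdsWithin_of_mem_nhds (Metric.ball_mem_nhds x hδ))
    self_mem_nhdsWithin

/-- Uniform local Lipschitz bounds near a compact set, with increments staying in `ω`. -/
theorem IsCompact.exists_forall_abs_sub_le_of_locally_lipschitz
    (hφ : ∀ x ∈ Ω, ∃ (K : NNReal) (δ : ℝ), 0 < δ ∧
      LipschitzOnWith K φ (Metric.ball x δ ∩ Ω))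
    {K ω : Set (Fin n → ℂ)} (hK : IsCompact K) (hωo : IsOpen ω) (hKω : K ⊆ ω) (hωΩ : ω ⊆ Ω) :
    ∃ L ≥ 0, ∃ r > 0, ∀ z ∈ K, ∀ w, ‖w‖ ≤ r → z + w ∈ ω ∧ |φ (z + w) - φ z| ≤ L * ‖w‖ := by
  let P : Set (Fin n → ℂ) → Prop := fun S => ∃ L ≥ 0, ∃ r > 0, ∀ z ∈ S, ∀ w, ‖w‖ ≤ r →
    z + w ∈ ω ∧ |φ (z + w) - φ z| ≤ L * ‖w‖
  change P K
  refine hK.induction_on ?_ ?_ ?_ ?_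
  · exact ⟨0, le_rfl, 1, one_pos, by simp⟩
  · rintro s t hst ⟨L, hL, r, hr, H⟩
    exact ⟨L, hL, r, hr, fun z hz => H z (hst hz)⟩
  · rintro s t ⟨L₁, hL₁, r₁, hr₁, H₁⟩ ⟨L₂, hL₂, r₂, hr₂, H₂⟩
    refine ⟨max L₁ L₂, le_max_of_le_left hL₁, min r₁ r₂, lt_min hr₁ hr₂, ?_⟩
    rintro z (hz | hz) w hw
    · obtain ⟨h1, h2⟩ := H₁ z hz w (hw.trans (min_le_left _ _))
      exact ⟨h1, h2.trans (by gcongr; exact le_max_left _ _)⟩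
    · obtain ⟨h1, h2⟩ := H₂ z hz w (hw.trans (min_le_right _ _))
      exact ⟨h1, h2.trans (by gcongr; exact le_max_right _ _)⟩
  · intro x hx
    obtain ⟨L, δ, hδ, hL⟩ := hφ x (hωΩ (hKω hx))
    obtain ⟨ε, hε, hεω⟩ := Metric.isOpen_iff.1 hωo x (hKω hx)
    have hη : 0 < min δ ε / 2 := by positivity
    refine ⟨Metric.ball x (min δ ε / 2), mem_nhdsWithin_of_mem_nhds (Metric.ball_mem_nhds x hη),
      L, L.2, min δ ε / 4, by positivity, fun z hz w hw => ?_⟩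
    have hzx : z ∈ Metric.ball x (min δ ε) := Metric.ball_subset_ball (by linarith) hz
    have hzw : z + w ∈ Metric.ball x (min δ ε) := by
      rw [Metric.mem_ball, dist_eq_norm] at hz ⊢
      calc ‖z + w - x‖ = ‖(z - x) + w‖ := by congr 1; abel
        _ ≤ ‖z - x‖ + ‖w‖ := norm_add_le _ _
        _ < min δ ε := by linarith
    have hmem : ∀ y ∈ Metric.ball x (min δ ε), y ∈ ω ∧ y ∈ Metric.ball x δ := fun y hy =>
      ⟨hεω (Metric.ball_subset_ball (min_le_right _ _) hy),
        Metric.ball_subset_ball (min_le_left _ _) hy⟩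
    refine ⟨(hmem _ hzw).1, ?_⟩
    have := hL.norm_sub_le ⟨(hmem _ hzw).2, hωΩ (hmem _ hzw).1⟩
      ⟨(hmem _ hzx).2, hωΩ (hmem _ hzx).1⟩
    simpa using this

theorem continuousOn_norm_sq_mul_exp (hφ : ContinuousOn φ Ω) {f : (Fin n → ℂ) → ℂ}
    (hf : ContinuousOn f Ω) (h : ℝ) :
    ContinuousOn (fun z => ‖f z‖ ^ 2 * Real.exp (-2 * φ z / h)) Ω :=
  (hf.norm.pow 2).mul (Real.continuous_exp.comp_continuousOn
    ((hφ.const_mul (-2)).div_const h))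

/-- The operator `D` maps functions holomorphic on `Ω` to such functions, and `h ^ m • D` obeys
interior `L²` bounds with weight `exp (-2 φ / h)`, uniformly in `h ∈ (0, 1]`. -/
def HasWeightedBound (Ω : Set (Fin n → ℂ)) (φ : (Fin n → ℂ) → ℝ)
    (D : ((Fin n → ℂ) → ℂ) → ((Fin n → ℂ) → ℂ)) (m : ℕ) : Prop :=
  (∀ f, DifferentiableOn ℂ f Ω → DifferentiableOn ℂ (D f) Ω) ∧
    ∀ K ω : Set (Fin n → ℂ), IsCompact K → IsOpen ω → K ⊆ ω → IsCompact (closure ω) →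
      closure ω ⊆ Ω → ∃ C > 0, ∀ h : ℝ, 0 < h → h ≤ 1 →
        ∀ f : (Fin n → ℂ) → ℂ, DifferentiableOn ℂ f Ω →
          (∫ z in K, ‖(h : ℂ) ^ m * D f z‖ ^ 2 * Real.exp (-2 * φ z / h)) ≤
            C ^ 2 * ∫ z in ω, ‖f z‖ ^ 2 * Real.exp (-2 * φ z / h)

theorem setIntegral_norm_sq_mul_exp_mono (hφ : ContinuousOn φ Ω) {f : (Fin n → ℂ) → ℂ}
    (hf : ContinuousOn f Ω) (h : ℝ) {s t T : Set (Fin n → ℂ)} (hst : s ⊆ t) (htT : t ⊆ T)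
    (hT : IsCompact T) (hTΩ : T ⊆ Ω) :
    ∫ z in s, ‖f z‖ ^ 2 * Real.exp (-2 * φ z / h) ≤
      ∫ z in t, ‖f z‖ ^ 2 * Real.exp (-2 * φ z / h) :=
  setIntegral_mono_set
    ((((continuousOn_norm_sq_mul_exp hφ hf h).mono hTΩ).integrableOn_compact hT).mono_set htT)
    (Filter.Eventually.of_forall fun z => by positivity) hst.eventuallyLE

theorem hasWeightedBound_id (hφ : ContinuousOn φ Ω) : HasWeightedBound Ω φ id 0 := by
  refine ⟨fun f hf => hf, fun K ω _ _ hKω hωc hωΩ => ⟨1, one_pos, fun h _ _ f hf => ?_⟩⟩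
  simpa using setIntegral_norm_sq_mul_exp_mono hφ hf.continuousOn h hKω subset_closure hωc hωΩ

theorem HasWeightedBound.comp (hφ : ContinuousOn φ Ω)
    {D₁ D₂ : ((Fin n → ℂ) → ℂ) → ((Fin n → ℂ) → ℂ)} {m₁ m₂ : ℕ}
    (h₁ : HasWeightedBound Ω φ D₁ m₁) (h₂ : HasWeightedBound Ω φ D₂ m₂) :
    HasWeightedBound Ω φ (D₁ ∘ D₂) (m₁ + m₂) := by
  refine ⟨fun f hf => h₁.1 _ (h₂.1 f hf), fun K ω hK hωo hKω hωc hωΩ => ?_⟩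
  obtain ⟨L, hL, hKL, hLω⟩ := exists_compact_between hK hωo hKω
  have hLΩ : L ⊆ Ω := (hLω.trans subset_closure).trans hωΩ
  have hcl : closure (interior L) ⊆ L := hL.isClosed.closure_interior_subset
  obtain ⟨C₁, hC₁, H₁⟩ := h₁.2 K (interior L) hK isOpen_interior hKL
    (hL.of_isClosed_subset isClosed_closure hcl) (hcl.trans hLΩ)
  obtain ⟨C₂, hC₂, H₂⟩ := h₂.2 L ω hL hωo hLω hωc hωΩ
  refine ⟨C₁ * C₂, mul_pos hC₁ hC₂, fun h hh hh1 f hf => ?_⟩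
  have hpull : ∀ (m : ℕ) (g : (Fin n → ℂ) → ℂ) (s : Set (Fin n → ℂ)),
      ∫ z in s, ‖(h : ℂ) ^ m * g z‖ ^ 2 * Real.exp (-2 * φ z / h) =
        (h ^ m) ^ 2 * ∫ z in s, ‖g z‖ ^ 2 * Real.exp (-2 * φ z / h) := by
    intro m g s
    rw [← integral_const_mul]
    congr 1 with z
    rw [norm_mul, norm_pow, Complex.norm_real, Real.norm_of_nonneg hh.le]
    ring
  have e₁ := H₁ h hh hh1 (D₂ f) (h₂.1 f hf)
  have e₂ := H₂ h hh hh1 f hf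
  have e₃ := setIntegral_norm_sq_mul_exp_mono hφ (h₂.1 f hf).continuousOn h
    (interior_subset (s := L)) subset_rfl hL hLΩ
  rw [hpull] at e₁ e₂ ⊢
  calc (h ^ (m₁ + m₂)) ^ 2 * ∫ z in K, ‖(D₁ ∘ D₂) f z‖ ^ 2 * Real.exp (-2 * φ z / h)
      = (h ^ m₂) ^ 2 *
        ((h ^ m₁) ^ 2 * ∫ z in K, ‖D₁ (D₂ f) z‖ ^ 2 * Real.exp (-2 * φ z / h)) := by
        simp only [Function.comp_apply]
        ring
    _ ≤ (h ^ m₂) ^ 2 * (C₁ ^ 2 * ∫ z in L, ‖D₂ f z‖ ^ 2 * Real.exp (-2 * φ z / h)) := by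
        refine mul_le_mul_of_nonneg_left (e₁.trans ?_) (sq_nonneg _)
        exact mul_le_mul_of_nonneg_left e₃ (sq_nonneg _)
    _ = C₁ ^ 2 * ((h ^ m₂) ^ 2 * ∫ z in L, ‖D₂ f z‖ ^ 2 * Real.exp (-2 * φ z / h)) := by ring
    _ ≤ C₁ ^ 2 * (C₂ ^ 2 * ∫ z in ω, ‖f z‖ ^ 2 * Real.exp (-2 * φ z / h)) := by gcongr
    _ = _ := by ring

theorem HasWeightedBound.iterate (hφ : ContinuousOn φ Ω)
    {D : ((Fin n → ℂ) → ℂ) → ((Fin n → ℂ) → ℂ)} (hD : HasWeightedBound Ω φ D 1) (k : ℕ) :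
    HasWeightedBound Ω φ D^[k] k := by
  induction k with
  | zero => exact hasWeightedBound_id hφ
  | succ k ih =>
    rw [Function.iterate_succ]
    exact ih.comp hφ hD

theorem hasWeightedBound_pderiv' (hΩ : IsOpen Ω)
    (hφ : ∀ x ∈ Ω, ∃ (K : NNReal) (δ : ℝ), 0 < δ ∧
      LipschitzOnWith K φ (Metric.ball x δ ∩ Ω)) (j : Fin n) :
    HasWeightedBound Ω φ (pderiv' j) 1 := by
  have hφc := continuousOn_of_forall_lipschitzOnWith_ball_inter hφ
  refine ⟨fun f hf => hf.pderiv' hΩ j, fun K ω hK hωo hKω hωc hωΩ => ?_⟩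
  obtain ⟨L, hL, r, hr, hLr⟩ := hK.exists_forall_abs_sub_le_of_locally_lipschitz hφ hωo hKω
    (subset_closure.trans hωΩ)
  refine ⟨Real.exp (L * r) / r, by positivity, fun h hh hh1 f hf => ?_⟩
  set g : (Fin n → ℂ) → ℝ := fun z => ‖f z‖ ^ 2 * Real.exp (-2 * φ z / h) with hg
  set τ : ℝ → Fin n → ℂ := fun θ => circleMap 0 (h * r) θ • Pi.single j 1 with hτ
  have hR : 0 < h * r := mul_pos hh hr
  have hnorm_single : ∀ w : ℂ, ‖w • (Pi.single j 1 : Fin n → ℂ)‖ = ‖w‖ := fun w => by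
    rw [norm_smul, Pi.norm_single, norm_one, mul_one]
  have hτnorm : ∀ θ, ‖τ θ‖ = h * r := fun θ => by
    rw [hτ, hnorm_single, norm_circleMap_zero, abs_of_pos hR]
  have hhr : h * r ≤ r := by nlinarith
  have hτmem : ∀ z ∈ K, ∀ θ, z + τ θ ∈ ω := fun z hz θ =>
    (hLr z hz _ ((hτnorm θ).trans_le hhr)).1
  have hτcont : Continuous τ := by fun_prop
  have hgc : ContinuousOn g Ω := continuousOn_norm_sq_mul_exp hφc hf.continuousOn h
  have hgcω : ContinuousOn g ω := hgc.mono (subset_closure.trans hωΩ)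
  have hgω : IntegrableOn g ω :=
    ((hgc.mono hωΩ).integrableOn_compact hωc).mono_set subset_closure
  have hg0 : ∀ z, 0 ≤ g z := fun z => by positivity
  have hweight : ∀ z ∈ K, ∀ θ, Real.exp (-2 * φ z / h) ≤
      Real.exp (2 * (L * r)) * Real.exp (-2 * φ (z + τ θ) / h) := by
    intro z hz θ
    have h1 := (hLr z hz _ ((hτnorm θ).trans_le hhr)).2
    rw [hτnorm] at h1
    have h2 := (abs_le.1 h1).2
    rw [← Real.exp_add, Real.exp_le_exp, div_le_iff₀ hh, add_mul, div_mul_cancel₀ _ hh.ne']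
    linarith
  have hprod : ContinuousOn (fun p : (Fin n → ℂ) × ℝ => g (p.1 + τ p.2))
      (K ×ˢ Set.Icc 0 (2 * π)) :=
    hgcω.comp (by fun_prop) fun p hp => hτmem p.1 hp.1 p.2
  have hprodInt : Integrable (Function.uncurry fun (z : Fin n → ℂ) (θ : ℝ) => g (z + τ θ))
      ((volume.restrict K).prod (volume.restrict (Set.Icc 0 (2 * π)))) := by
    rw [Measure.prod_restrict]
    exact hprod.integrableOn_compact (hK.prod isCompact_Icc)
  have hpoint : ∀ z ∈ K, ‖(h : ℂ) ^ 1 * _root_.pderiv' j f z‖ ^ 2 * Real.exp (-2 * φ z / h) ≤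
      (Real.exp (L * r) / r) ^ 2 * ((2 * π)⁻¹ * ∫ θ in Set.Icc 0 (2 * π), g (z + τ θ)) := by
    intro z hz
    have hdiff : ∀ w : ℂ, ‖w‖ ≤ h * r → DifferentiableAt ℂ f (z + w • Pi.single j 1) :=
      fun w hw => hf.differentiableAt (hΩ.mem_nhds (hωΩ (subset_closure
        (hLr z hz _ ((hnorm_single w).trans_le (hw.trans hhr))).1)))
    have hcauchy := norm_fderiv_apply_sq_le_setIntegral_circleMap hR hdiff
    have hcz : ContinuousOn (fun θ => ‖f (z + τ θ)‖ ^ 2) (Set.Icc 0 (2 * π)) :=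
      ((hf.continuousOn.comp (f := fun θ => z + τ θ) (by fun_prop) fun θ _ =>
        hωΩ (subset_closure (hτmem z hz θ))).norm.pow 2)
    have hgz : ContinuousOn (fun θ => g (z + τ θ)) (Set.Icc 0 (2 * π)) :=
      hgcω.comp (f := fun θ => z + τ θ) (by fun_prop) fun θ _ => hτmem z hz θ
    have hmono : (∫ θ in Set.Icc 0 (2 * π), ‖f (z + τ θ)‖ ^ 2) * Real.exp (-2 * φ z / h) ≤
        Real.exp (2 * (L * r)) * ∫ θ in Set.Icc 0 (2 * π), g (z + τ θ) := by
      rw [← integral_mul_const, ← integral_const_mul]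
      refine setIntegral_mono_on (hcz.mul continuousOn_const).integrableOn_Icc
        (hgz.const_mul _).integrableOn_Icc measurableSet_Icc fun θ _ => ?_
      have := mul_le_mul_of_nonneg_left (hweight z hz θ) (sq_nonneg ‖f (z + τ θ)‖)
      calc _ ≤ _ := this
        _ = _ := by simp only [hg]; ring
    calc ‖(h : ℂ) ^ 1 * _root_.pderiv' j f z‖ ^ 2 * Real.exp (-2 * φ z / h)
        = h ^ 2 * ‖fderiv ℂ f z (Pi.single j 1)‖ ^ 2 * Real.exp (-2 * φ z / h) := by
          rw [pow_one, norm_mul, Complex.norm_real, Real.norm_of_nonneg hh.le, mul_pow]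
          rfl
      _ ≤ h ^ 2 * (((h * r) ^ 2)⁻¹ * ((2 * π)⁻¹ *
            ∫ θ in Set.Icc 0 (2 * π), ‖f (z + τ θ)‖ ^ 2)) * Real.exp (-2 * φ z / h) := by
          gcongr
      _ = (r ^ 2)⁻¹ * ((2 * π)⁻¹ * ((∫ θ in Set.Icc 0 (2 * π), ‖f (z + τ θ)‖ ^ 2) *
            Real.exp (-2 * φ z / h))) := by
          field_simp
      _ ≤ (r ^ 2)⁻¹ * ((2 * π)⁻¹ * (Real.exp (2 * (L * r)) *
            ∫ θ in Set.Icc 0 (2 * π), g (z + τ θ))) := by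
          gcongr
      _ = _ := by
          rw [two_mul (L * r), Real.exp_add]
          field_simp
  have hshift : ∀ θ, ∫ z in K, g (z + τ θ) ≤ ∫ z in ω, g z := by
    intro θ
    have hmp := measurePreserving_add_right (volume : Measure (Fin n → ℂ)) (τ θ)
    have hemb := (Homeomorph.addRight (τ θ)).measurableEmbedding
    have himage := hmp.setIntegral_image_emb hemb g K
    rw [← himage]
    refine setIntegral_mono_set hgω (Filter.Eventually.of_forall hg0)
      (LE.le.eventuallyLE ?_)
    rintro _ ⟨z, hz, rfl⟩
    exact hτmem z hz θ
  have hleft : IntegrableOn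
      (fun z => ‖(h : ℂ) ^ 1 * _root_.pderiv' j f z‖ ^ 2 * Real.exp (-2 * φ z / h)) K :=
    ((continuousOn_norm_sq_mul_exp hφc (f := fun z => (h : ℂ) ^ 1 * _root_.pderiv' j f z)
      ((hf.pderiv' hΩ j).continuousOn.const_mul _) h).mono
        ((hKω.trans subset_closure).trans hωΩ)).integrableOn_compact hK
  calc ∫ z in K, ‖(h : ℂ) ^ 1 * _root_.pderiv' j f z‖ ^ 2 * Real.exp (-2 * φ z / h)
      ≤ ∫ z in K, (Real.exp (L * r) / r) ^ 2 *
          ((2 * π)⁻¹ * ∫ θ in Set.Icc 0 (2 * π), g (z + τ θ)) :=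
        setIntegral_mono_on hleft ((hprodInt.integral_prod_left.const_mul _).const_mul _)
          hK.measurableSet hpoint
    _ = (Real.exp (L * r) / r) ^ 2 *
          ((2 * π)⁻¹ * ∫ θ in Set.Icc 0 (2 * π), ∫ z in K, g (z + τ θ)) := by
        rw [integral_const_mul, integral_const_mul, integral_integral_swap hprodInt]
    _ ≤ (Real.exp (L * r) / r) ^ 2 *
          ((2 * π)⁻¹ * ∫ _ in Set.Icc 0 (2 * π), ∫ z in ω, g z) := by
        gcongr
        · exact hprodInt.integral_prod_right
        · exact continuousOn_const.integrableOn_Icc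
        · exact measurableSet_Icc.nullMeasurableSet
        · exact hshift _
    _ = _ := by
        have := Real.pi_pos
        rw [setIntegral_const, Real.volume_real_Icc_of_le Real.two_pi_pos.le, smul_eq_mul]
        field_simp
        ring

theorem hasWeightedBound_foldr (hΩ : IsOpen Ω)
    (hφ : ∀ x ∈ Ω, ∃ (K : NNReal) (δ : ℝ), 0 < δ ∧
      LipschitzOnWith K φ (Metric.ball x δ ∩ Ω)) (α : Fin n → ℕ) (l : List (Fin n)) :
    HasWeightedBound Ω φ ((l.map fun j => (pderiv' j)^[α j]).foldr (· ∘ ·) id)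
      (l.map α).sum := by
  have hφc := continuousOn_of_forall_lipschitzOnWith_ball_inter hφ
  induction l with
  | nil => exact hasWeightedBound_id hφc
  | cons j l ih =>
    simpa using ((hasWeightedBound_pderiv' hΩ hφ j).iterate hφc (α j)).comp hφc ih

end WeightedEstimates

/-- **Lemma (weighted Cauchy estimates for holomorphic functions).** -/
theorem weighted_cauchy_estimates {n : ℕ}
    (Ω : Set (Fin n → ℂ)) (hΩ : IsOpen Ω)
    (φ : (Fin n → ℂ) → ℝ)
    (hφlip : ∀ x ∈ Ω, ∃ (K : NNReal) (δ : ℝ), 0 < δ ∧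
      LipschitzOnWith K φ (Metric.ball x δ ∩ Ω))
    (K : Set (Fin n → ℂ)) (hK : IsCompact K) (hKΩ : K ⊆ Ω)
    (ω : Set (Fin n → ℂ)) (hωo : IsOpen ω) (hKω : K ⊆ ω)
    (hωc : IsCompact (closure ω)) (hωΩ : closure ω ⊆ Ω)
    (α : Fin n → ℕ) :
    ∃ C > 0, ∀ h : ℝ, 0 < h → h ≤ 1 →
      ∀ f : (Fin n → ℂ) → ℂ, DifferentiableOn ℂ f Ω →
        (∫ z in K, ‖(h : ℂ) ^ (∑ j, α j) * mderiv α f z‖ ^ 2 * Real.exp (-2 * φ z / h)) ≤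
          C ^ 2 * ∫ z in ω, ‖f z‖ ^ 2 * Real.exp (-2 * φ z / h) := by
  have hsum : ((List.finRange n).map α).sum = ∑ j, α j := (Fin.sum_univ_def α).symm
  have hbound := hasWeightedBound_foldr hΩ hφlip α (List.finRange n)
  rw [hsum] at hbound
  exact hbound.2 K ω hK hωo hKω hωc hωΩ
end
end
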